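/- arXiv:0911.1652 — 2 statements merged into one kernel-verified Lean document; each statement's English description precedes it below -/
import Mathlib

section
/- Let m be a Coifman–Meyer symbol on ℝ^{2d} with compact support and let φ be a smooth real-valued function on ℝ^{2d} such that for some multi-index α on ℝ^{2d} with |α| ≥ 2 there is a constant c > 0 with |∂^α φ(η,ξ)| ≥ c at every point of supp m. Then there exists a constant C such that for all λ ≥ 1 and all Schwartz functions f, g on ℝ^d, ‖B_λ(f,g)‖_{L^∞} ≤ C λ^{−1/(2|α|)} ‖f‖_{L^1} ‖g‖_{L^1}. -/
open MeasureTheory Filter Complex SchwartzMap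
open scoped RealInnerProductSpace ENNReal

noncomputable section

/-- Euclidean space `ℝ^d`. -/
abbrev E (d : ℕ) : Type := EuclideanSpace ℝ (Fin d)

/-- The Fourier transform `(2π)^{-d/2} ∫ e^{-i x·ξ} f(x) dx`. -/
def FT {d : ℕ} (f : E d → ℂ) (ξ : E d) : ℂ :=
  (((2 * Real.pi) ^ (-(d : ℝ) / 2) : ℝ) : ℂ) *
    ∫ x : E d, Complex.exp (-(Complex.I * ((⟪x, ξ⟫ : ℝ) : ℂ))) * f x

/-- The bilinear oscillatory integral `B_λ(f,g)` with symbol `m` and phase `φ`. -/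
def Bop {d : ℕ} (m : E d × E d → ℂ) (φ : E d × E d → ℝ) (lam : ℝ)
    (f g : 𝓢(E d, ℂ)) (x : E d) : ℂ :=
  (((2 * Real.pi) ^ (-(d : ℝ) / 2) : ℝ) : ℂ) *
    ∫ p : E d × E d,
      Complex.exp (Complex.I * ((⟪x, p.1 + p.2⟫ + lam * φ p : ℝ) : ℂ)) *
        m p * FT (⇑f) p.1 * FT (⇑g) p.2

/-- Standard basis vector of `ℝ^d`. -/
def ev {d : ℕ} (i : Fin d) : E d := EuclideanSpace.single i 1

/-- The direction corresponding to `∂_{η_i}`. -/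
def etaV {d : ℕ} (i : Fin d) : E d × E d := (ev i, 0)

/-- The direction corresponding to `∂_{ξ_i}`. -/
def xiV {d : ℕ} (i : Fin d) : E d × E d := (0, ev i)

/-- Iterated (second) directional derivative: first in direction `u`, then in direction `v`. -/
def D2 {V : Type*} [NormedAddCommGroup V] [NormedSpace ℝ V]
    (φ : V → ℝ) (x u v : V) : ℝ :=
  fderiv ℝ (fun y => fderiv ℝ φ y u) x v

/-- The full `2d × 2d` Hessian matrix of `φ` at `x` in the variables `(η,ξ)`. -/
def hessMat {d : ℕ} (φ : E d × E d → ℝ) (x : E d × E d) :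
    Matrix (Fin d ⊕ Fin d) (Fin d ⊕ Fin d) ℝ :=
  Matrix.of fun i j => D2 φ x (Sum.elim etaV xiV j) (Sum.elim etaV xiV i)

/-- The `d × d` matrix `(A_i B_j φ)_{i,j}` for families of first-order directions `A`, `B`. -/
def derMat {d : ℕ} (φ : E d × E d → ℝ) (x : E d × E d)
    (A B : Fin d → E d × E d) : Matrix (Fin d) (Fin d) ℝ :=
  Matrix.of fun i j => D2 φ x (B j) (A i)

/-- A Coifman–Meyer symbol: smooth away from the origin, with derivative bounds
`|∂^α m(η,ξ)| ≤ C_α (|η|+|ξ|)^{-|α|}` for all orders. -/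
def CoifmanMeyer {d : ℕ} (m : E d × E d → ℂ) : Prop :=
  ContDiffOn ℝ (⊤ : ℕ∞) m {p : E d × E d | p ≠ 0} ∧
    ∀ n : ℕ, ∃ C : ℝ, 0 < C ∧ ∀ p : E d × E d, p ≠ 0 →
      ‖iteratedFDerivWithin ℝ n m {q : E d × E d | q ≠ 0} p‖ ≤
        C * (‖p.1‖ + ‖p.2‖) ^ (-(n : ℝ))

lemma pol_aux {n : ℕ} {V : Type*} [NormedAddCommGroup V] [NormedSpace ℝ V]
    (A : ContinuousMultilinearMap ℝ (fun _ : Fin n => V) ℝ)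
    (hA : ∀ (σ : Equiv.Perm (Fin n)) (v : Fin n → V), A (fun i => v (σ i)) = A v)
    (v : Fin n → V) (h : A v ≠ 0) : ∃ w : V, A (fun _ => w) ≠ 0 := by
  by_contra hcon
  push Not at hcon
  apply h
  have key : ∑ e : Fin n → ℤˣ, ((∏ i, ((e i : ℤ) : ℝ)) * A (fun _ => ∑ j, ((e j : ℤ) : ℝ) • v j)) = 0 := by
    apply Finset.sum_eq_zero
    intro e _
    rw [hcon, mul_zero]
  have exp : ∀ e : Fin n → ℤˣ, A (fun _ => ∑ j, ((e j : ℤ) : ℝ) • v j)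
      = ∑ r : Fin n → Fin n, (∏ i, ((e (r i) : ℤ) : ℝ)) * A (fun i => v (r i)) := by
    intro e
    have := A.toMultilinearMap.map_sum (fun (_ : Fin n) (j : Fin n) => ((e j : ℤ) : ℝ) • v j)
    simp only [ContinuousMultilinearMap.coe_coe] at this
    rw [this]
    refine Finset.sum_congr rfl fun r _ => ?_
    have := A.map_smul_univ (fun i => ((e (r i) : ℤ) : ℝ)) (fun i => v (r i))
    rw [this, smul_eq_mul]
  simp_rw [exp, Finset.mul_sum] at key
  rw [Finset.sum_comm] at key
  have term : ∀ r : Fin n → Fin n,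
      ∑ e : Fin n → ℤˣ, ((∏ i, ((e i : ℤ) : ℝ)) * ((∏ i, ((e (r i) : ℤ) : ℝ)) * A (fun i => v (r i))))
      = if Function.Bijective r then (Fintype.card (Fin n → ℤˣ) : ℝ) * A v else 0 := by
    intro r
    split_ifs with hr
    · have h1 : ∀ e : Fin n → ℤˣ, ((∏ i, ((e i : ℤ) : ℝ)) * ((∏ i, ((e (r i) : ℤ) : ℝ)) * A (fun i => v (r i)))) = A v := by
        intro e
        have h2 : A (fun i => v (r i)) = A v := by
          simpa using hA (Equiv.ofBijective r hr) v
        have h3 : ∏ i, ((e (r i) : ℤ) : ℝ) = ∏ i, ((e i : ℤ) : ℝ) :=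
          Function.Bijective.prod_comp hr (fun i => ((e i : ℤ) : ℝ))
        rw [h2, h3, ← mul_assoc, ← Finset.prod_mul_distrib]
        have h4 : ∀ i, ((e i : ℤ) : ℝ) * ((e i : ℤ) : ℝ) = 1 := by
          intro i
          rcases Int.units_eq_one_or (e i) with h | h <;> simp [h]
        simp [h4]
      simp_rw [h1]
      simp
    · have hs : ¬ Function.Surjective r := fun hs => hr (Finite.surjective_iff_bijective.mp hs)
      simp only [Function.Surjective, not_forall, not_exists] at hs
      obtain ⟨j, hj⟩ := hs
      set F : (Fin n → ℤˣ) → ℝ := fun e => ((∏ i, ((e i : ℤ) : ℝ)) * ((∏ i, ((e (r i) : ℤ) : ℝ)) * A (fun i => v (r i)))) with hF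
      let s : Fin n → ℤˣ := Pi.mulSingle j (-1)
      have e1 : ∑ e, F (e * s) = ∑ e, F e := Equiv.sum_comp (Equiv.mulRight s) F
      have e2 : ∀ e, F (e * s) = - F e := by
        intro e
        have a1 : ∏ i, (((e * s) i : ℤ) : ℝ) = - ∏ i, ((e i : ℤ) : ℝ) := by
          simp only [Pi.mul_apply, Units.val_mul, Int.cast_mul, Finset.prod_mul_distrib]
          have : ∏ i, ((s i : ℤ) : ℝ) = -1 := by
            rw [Finset.prod_eq_single j]
            · simp [s]
            · intro b _ hb
              simp [s, Pi.mulSingle_eq_of_ne hb]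
            · simp
          rw [this]; ring
        have a2 : ∏ i, (((e * s) (r i) : ℤ) : ℝ) = ∏ i, ((e (r i) : ℤ) : ℝ) := by
          refine Finset.prod_congr rfl fun i _ => ?_
          simp [s, Pi.mulSingle_eq_of_ne (hj i)]
        simp only [hF, a1, a2]; ring
      simp_rw [e2] at e1
      rw [Finset.sum_neg_distrib] at e1
      change ∑ e, F e = 0
      linarith
  simp_rw [term] at key
  rw [← Finset.sum_filter, Finset.sum_const, nsmul_eq_mul] at key
  have hne : ((Finset.univ.filter (fun r : Fin n → Fin n => Function.Bijective r)).card : ℝ) ≠ 0 := by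
    have : (Finset.univ.filter (fun r : Fin n → Fin n => Function.Bijective r)).Nonempty :=
      ⟨id, Finset.mem_filter.mpr ⟨Finset.mem_univ _, Function.bijective_id⟩⟩
    exact_mod_cast this.card_pos.ne'
  have hne2 : (Fintype.card (Fin n → ℤˣ) : ℝ) ≠ 0 := by
    exact_mod_cast Fintype.card_ne_zero
  exact ((mul_eq_zero.mp ((mul_eq_zero.mp key).resolve_left hne)).resolve_left hne2)

/-- Iterated directional derivatives along a list of directions. -/
def dd {V : Type*} [NormedAddCommGroup V] [NormedSpace ℝ V] (φ : V → ℝ) : List V → V → ℝ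
  | [] => φ
  | u :: l => fun p => fderiv ℝ (dd φ l) p u

lemma dd_smooth {V : Type*} [NormedAddCommGroup V] [NormedSpace ℝ V] (φ : V → ℝ)
    (hφ : ContDiff ℝ (⊤ : ℕ∞) φ) (l : List V) : ContDiff ℝ (⊤ : ℕ∞) (dd φ l) := by
  induction l with
  | nil => exact hφ
  | cons u l ih =>
    simp only [dd]
    exact (ih.fderiv_right (m := (⊤ : ℕ∞)) (by simp)).clm_apply contDiff_const

lemma dd_perm {V : Type*} [NormedAddCommGroup V] [NormedSpace ℝ V] (φ : V → ℝ)
    (hφ : ContDiff ℝ (⊤ : ℕ∞) φ) {l l' : List V} (h : l.Perm l') : dd φ l = dd φ l' := by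
  induction h with
  | nil => rfl
  | cons x _ ih => simp only [dd, ih]
  | trans _ _ h1 h2 => exact h1.trans h2
  | swap x y l =>
    funext p
    simp only [dd]
    have hs := dd_smooth φ hφ l
    have hd : DifferentiableAt ℝ (fderiv ℝ (dd φ l)) p :=
      ((hs.fderiv_right (m := (⊤ : ℕ∞)) (by simp)).differentiable (by simp)) p
    have hsym : IsSymmSndFDerivAt ℝ (dd φ l) p := by
      refine (hs.contDiffAt).isSymmSndFDerivAt ?_
      simp only [minSmoothness_of_isRCLikeNormedField]
      exact WithTop.coe_le_coe.mpr (le_top : (2 : ℕ∞) ≤ ⊤)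
    have e : ∀ a b : V, fderiv ℝ (fun q => fderiv ℝ (dd φ l) q a) p b
        = fderiv ℝ (fderiv ℝ (dd φ l)) p b a := by
      intro a b
      rw [fderiv_clm_apply hd (differentiableAt_const a)]
      simp
    rw [e, e]
    exact hsym _ _

lemma iter_eq_dd {V : Type*} [NormedAddCommGroup V] [NormedSpace ℝ V] (φ : V → ℝ)
    (hφ : ContDiff ℝ (⊤ : ℕ∞) φ) : ∀ (n : ℕ) (v : Fin n → V) (p : V),
    iteratedFDeriv ℝ n φ p v = dd φ (List.ofFn v) p := by
  intro n
  induction n with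
  | zero => intro v p; simp [dd]
  | succ n ih =>
    intro v p
    rw [iteratedFDeriv_succ_apply_left, List.ofFn_succ]
    simp only [dd]
    have : dd φ (List.ofFn fun i => v i.succ) = fun q => iteratedFDeriv ℝ n φ q (Fin.tail v) := by
      funext q; rw [ih]; rfl
    rw [this]
    have hd : DifferentiableAt ℝ (iteratedFDeriv ℝ n φ) p :=
      (hφ.differentiable_iteratedFDeriv (m := n) (by exact_mod_cast WithTop.coe_lt_top _)) p
    rw [fderiv_continuousMultilinear_apply_const_apply hd]

lemma pol {n : ℕ} {V : Type*} [NormedAddCommGroup V] [NormedSpace ℝ V] (φ : V → ℝ)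
    (hφ : ContDiff ℝ (⊤ : ℕ∞) φ) (p : V) (v : Fin n → V) (h : iteratedFDeriv ℝ n φ p v ≠ 0) :
    ∃ w : V, dd φ (List.replicate n w) p ≠ 0 := by
  obtain ⟨w, hw⟩ := pol_aux (iteratedFDeriv ℝ n φ p) (fun σ v => by
    rw [iter_eq_dd φ hφ, iter_eq_dd φ hφ]
    exact congrFun (dd_perm φ hφ (Equiv.Perm.ofFn_comp_perm σ v)) p) v h
  refine ⟨w, ?_⟩
  rwa [iter_eq_dd φ hφ, List.ofFn_const] at hw

lemma rolle_aux (k : ℕ) : ∀ (F : ℕ → ℝ → ℝ) (_ : ∀ j t, HasDerivAt (F j) (F (j + 1) t) t)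
    (I : Set ℝ) (_ : I.OrdConnected) (η s : ℝ) (_ : 0 < η) (t : ℕ → ℝ)
    (_ : ∀ i < 2 ^ k, t i ∈ I ∧ |F 0 (t i)| ≤ s) (_ : ∀ i, i + 1 < 2 ^ k → t i + η ≤ t (i + 1)),
    ∃ u ∈ I, |F k u| ≤ (2 / η) ^ k * s := by
  induction k with
  | zero =>
    intro F hF I hI η s hη t ht1 ht2
    exact ⟨t 0, (ht1 0 (by simp)).1, by simpa using (ht1 0 (by simp)).2⟩
  | succ k ih =>
    intro F hF I hI η s hη t ht1 ht2
    have hex : ∀ i, ∃ x, i < 2 ^ k → (x ∈ Set.Ioo (t (2 * i)) (t (2 * i + 1)) ∧ |F 1 x| ≤ 2 / η * s) := by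
      intro i
      by_cases hi : i < 2 ^ k
      · have hp : 2 ^ (k + 1) = 2 * 2 ^ k := by ring
        have hg := ht2 (2 * i) (by omega)
        obtain ⟨x, hx, hx2⟩ := exists_hasDerivAt_eq_slope (F 0) (F 1) (a := t (2 * i)) (b := t (2 * i + 1))
          (by linarith) (fun x _ => (hF 0 x).continuousAt.continuousWithinAt) (fun x _ => hF 0 x)
        refine ⟨x, fun _ => ⟨hx, ?_⟩⟩
        rw [hx2, abs_div, abs_of_pos (show 0 < t (2 * i + 1) - t (2 * i) by linarith)]
        have b1 := (ht1 (2 * i) (by omega)).2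
        have b2 := (ht1 (2 * i + 1) (by omega)).2
        have hs : 0 ≤ s := (abs_nonneg _).trans b1
        rw [div_le_iff₀ (by linarith)]
        have : |F 0 (t (2 * i + 1)) - F 0 (t (2 * i))| ≤ 2 * s := by
          have := abs_sub (F 0 (t (2 * i + 1))) (F 0 (t (2 * i)))
          linarith
        refine this.trans ?_
        have h3 : 2 / η * s * η = 2 * s := by field_simp
        rw [← h3]
        gcongr
        linarith
      · exact ⟨0, fun h => absurd h hi⟩
    choose x hx using hex
    have hp : 2 ^ (k + 1) = 2 * 2 ^ k := by ring
    obtain ⟨u, hu, hu2⟩ := ih (fun j => F (j + 1)) (fun j t => hF (j + 1) t) I hI η (2 / η * s) hη x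
      (by
        intro i hi
        obtain ⟨h1, h2⟩ := hx i hi
        exact ⟨hI.out (ht1 (2 * i) (by omega)).1 (ht1 (2 * i + 1) (by omega)).1 ⟨h1.1.le, h1.2.le⟩, h2⟩)
      (by
        intro i hi
        have h1 := (hx i (by omega)).1
        have h2 := (hx (i + 1) hi).1
        have h3 := ht2 (2 * i + 1) (by omega)
        have h4 : 2 * (i + 1) = 2 * i + 1 + 1 := by ring
        rw [h4] at h2
        linarith [h1.2, h2.1])
    refine ⟨u, hu, hu2.trans (le_of_eq ?_)⟩
    ring

lemma sep_points (N : ℕ) : ∀ (S : Set ℝ) (_ : IsCompact S) (η : ℝ) (_ : 0 < η)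
    (_ : ENNReal.ofReal (N * η) < volume S),
    ∃ t : ℕ → ℝ, (∀ i ≤ N, t i ∈ S) ∧ ∀ i < N, t i + η ≤ t (i + 1) := by
  induction N with
  | zero =>
    intro S hS η hη hv
    have : S.Nonempty := nonempty_of_measure_ne_zero (μ := volume) (by
      intro h; simp [h] at hv)
    obtain ⟨x, hx⟩ := this
    exact ⟨fun _ => x, fun _ _ => hx, by simp⟩
  | succ N ih =>
    intro S hS η hη hv
    have hne : S.Nonempty := nonempty_of_measure_ne_zero (μ := volume) (by
      intro h; simp [h] at hv)
    obtain ⟨a, ha, hmin⟩ := hS.exists_isLeast hne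
    have hsub : S ⊆ Set.Ico a (a + η) ∪ (S ∩ Set.Ici (a + η)) := by
      intro x hx
      rcases lt_or_ge x (a + η) with h | h
      · exact Or.inl ⟨hmin hx, h⟩
      · exact Or.inr ⟨hx, h⟩
    have hm := (measure_mono (μ := volume) hsub).trans (measure_union_le _ _)
    rw [Real.volume_Ico] at hm
    have : ENNReal.ofReal (N * η) < volume (S ∩ Set.Ici (a + η)) := by
      by_contra hcon
      push Not at hcon
      have h1 : volume S ≤ ENNReal.ofReal (a + η - a) + ENNReal.ofReal (N * η) :=
        hm.trans (by gcongr)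
      rw [← ENNReal.ofReal_add (by linarith) (by positivity)] at h1
      have h2 : a + η - a + N * η = ((N + 1 : ℕ) : ℝ) * η := by push_cast; ring
      rw [h2] at h1
      exact absurd hv (not_lt.mpr h1)
    obtain ⟨t, ht1, ht2⟩ := ih _ (hS.inter_right isClosed_Ici) η hη this
    refine ⟨fun i => if i = 0 then a else t (i - 1), ?_, ?_⟩
    · intro i hi
      rcases Nat.eq_zero_or_pos i with h | h
      · simp [h, ha]
      · simp only [h.ne', if_false]
        exact (ht1 (i - 1) (by omega)).1
    · intro i hi
      rcases Nat.eq_zero_or_pos i with h | h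
      · simpa [h] using (ht1 0 (by omega)).2
      · have := ht2 (i - 1) (by omega)
        simp only [h.ne', if_false, Nat.add_eq_zero_iff, one_ne_zero, and_false, Nat.add_sub_cancel]
        rwa [Nat.sub_add_cancel h] at this

/-- One-dimensional sublevel set estimate. -/
lemma sublevel1 (k : ℕ) (F : ℕ → ℝ → ℝ) (hF : ∀ j t, HasDerivAt (F j) (F (j + 1) t) t)
    (I : Set ℝ) (hI : I.OrdConnected) (hIc : IsCompact I) (c s η : ℝ) (hη : 0 < η)
    (hc : ∀ t ∈ I, c ≤ |F k t|) (hlt : (2 / η) ^ k * s < c) :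
    volume (I ∩ {t | |F 0 t| ≤ s}) ≤ ENNReal.ofReal (2 ^ k * η) := by
  by_contra hcon
  push Not at hcon
  have hcomp : IsCompact (I ∩ {t | |F 0 t| ≤ s}) := by
    refine hIc.inter_right ?_
    have : Continuous (F 0) := continuous_iff_continuousAt.mpr fun t => (hF 0 t).continuousAt
    exact isClosed_le this.abs continuous_const
  obtain ⟨t, ht1, ht2⟩ := sep_points (2 ^ k) _ hcomp η hη (by push_cast; exact hcon)
  obtain ⟨u, hu, hu2⟩ := rolle_aux k F hF I hI η s hη t (fun i hi => ht1 i hi.le)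
    (fun i hi => ht2 i (by omega))
  exact absurd (hc u hu) (not_le.mpr (hu2.trans_lt hlt))

lemma dd_line {V : Type*} [NormedAddCommGroup V] [NormedSpace ℝ V] (φ : V → ℝ)
    (hφ : ContDiff ℝ (⊤ : ℕ∞) φ) (l : List V) (p v : V) (t : ℝ) :
    HasDerivAt (fun t : ℝ => dd φ l (p + t • v)) (dd φ (v :: l) (p + t • v)) t := by
  have h1 : HasFDerivAt (dd φ l) (fderiv ℝ (dd φ l) (p + t • v)) (p + t • v) :=
    ((dd_smooth φ hφ l).differentiable (by simp) _).hasFDerivAt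
  have h2 : HasDerivAt (fun t : ℝ => p + t • v) v t := by
    simpa using ((hasDerivAt_id t).smul_const v).const_add p
  exact h1.comp_hasDerivAt t h2

lemma average {V : Type*} [NormedAddCommGroup V] [NormedSpace ℝ V] [FiniteDimensional ℝ V]
    [MeasurableSpace V] [BorelSpace V] (μ : Measure V) [μ.IsAddHaarMeasure]
    (S : Set V) (hS : IsClosed S) (p0 v : V) (R : ℝ) (hSR : S ⊆ Metric.closedBall p0 R) (δ : ℝ≥0∞)
    (hδ : ∀ p, volume (Set.Icc (0:ℝ) 1 ∩ {t : ℝ | p + t • v ∈ S}) ≤ δ) :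
    μ S ≤ δ * μ (Metric.closedBall p0 (R + ‖v‖)) := by
  have hmeas : Measurable (Function.uncurry fun (t : ℝ) (p : V) => S.indicator (fun _ => (1:ℝ≥0∞)) (p + t • v)) := by
    refine (measurable_const.indicator hS.measurableSet).comp ?_
    fun_prop
  have h1 : μ S = ∫⁻ _t in Set.Icc (0:ℝ) 1, μ S := by
    simp
  have h2 : ∀ t : ℝ, μ S = ∫⁻ p, S.indicator (fun _ => (1:ℝ≥0∞)) (p + t • v) ∂μ := by
    intro t
    rw [lintegral_add_right_eq_self (fun p => S.indicator (fun _ => (1:ℝ≥0∞)) p) (t • v),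
      lintegral_indicator hS.measurableSet]
    simp
  rw [h1]
  calc ∫⁻ _t in Set.Icc (0:ℝ) 1, μ S
      = ∫⁻ t in Set.Icc (0:ℝ) 1, ∫⁻ p, S.indicator (fun _ => (1:ℝ≥0∞)) (p + t • v) ∂μ :=
        lintegral_congr fun t => h2 t
    _ = ∫⁻ p, (∫⁻ t in Set.Icc (0:ℝ) 1, S.indicator (fun _ => (1:ℝ≥0∞)) (p + t • v)) ∂μ :=
        lintegral_lintegral_swap hmeas.aemeasurable
    _ ≤ ∫⁻ p, (Metric.closedBall p0 (R + ‖v‖)).indicator (fun _ => δ) p ∂μ := by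
        refine lintegral_mono fun p => ?_
        have hcl : IsClosed {t : ℝ | p + t • v ∈ S} := hS.preimage (by fun_prop)
        have e : ∀ t : ℝ, S.indicator (fun _ => (1:ℝ≥0∞)) (p + t • v)
            = {t : ℝ | p + t • v ∈ S}.indicator (fun _ => 1) t := fun t => rfl
        simp_rw [e]
        rw [lintegral_indicator hcl.measurableSet, setLIntegral_one, Measure.restrict_apply hcl.measurableSet,
          Set.inter_comm]
        by_cases hp : p ∈ Metric.closedBall p0 (R + ‖v‖)
        · simpa [hp] using hδ p
        · rw [Set.indicator_of_notMem hp]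
          have : Set.Icc (0:ℝ) 1 ∩ {t : ℝ | p + t • v ∈ S} = ∅ := by
            rw [Set.eq_empty_iff_forall_notMem]
            rintro t ⟨ht, ht2⟩
            apply hp
            have h3 := hSR ht2
            rw [Metric.mem_closedBall, dist_eq_norm] at h3 ⊢
            have h4 : p - p0 = (p + t • v - p0) - t • v := by abel
            rw [h4]
            refine (norm_sub_le _ _).trans ?_
            have : ‖t • v‖ ≤ ‖v‖ := by
              rw [norm_smul, Real.norm_eq_abs, abs_of_nonneg ht.1]
              exact mul_le_of_le_one_left (norm_nonneg _) ht.2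
            linarith
          rw [this]; simp
    _ = δ * μ (Metric.closedBall p0 (R + ‖v‖)) := by
        rw [lintegral_indicator Metric.isClosed_closedBall.measurableSet]
        simp

lemma sublevelV {V : Type*} [NormedAddCommGroup V] [NormedSpace ℝ V] [FiniteDimensional ℝ V]
    [MeasurableSpace V] [BorelSpace V] (μ : Measure V) [μ.IsAddHaarMeasure]
    (φ : V → ℝ) (hφ : ContDiff ℝ (⊤ : ℕ∞) φ) (k : ℕ) (hk : 1 ≤ k) (p0 v : V) (R c : ℝ) (hc0 : 0 < c)
    (hc : ∀ p ∈ Metric.closedBall p0 R, c ≤ |dd φ (List.replicate (k + 1) v) p|) :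
    ∃ C : ℝ, 0 ≤ C ∧ ∀ s : ℝ, 0 < s → ∀ b : ℝ,
      μ.real (Metric.closedBall p0 R ∩ {p | |dd φ [v] p + b| ≤ s}) ≤ C * s ^ (1 / (k : ℝ)) := by
  refine ⟨2 ^ k * (2 * (2 / c) ^ (1 / (k : ℝ))) * μ.real (Metric.closedBall p0 (R + ‖v‖)),
    by positivity, fun s hs b => ?_⟩
  have hcont : Continuous (dd φ [v]) := (dd_smooth φ hφ [v]).continuous
  have hk0 : (k : ℝ) ≠ 0 := by positivity
  set η : ℝ := 2 * (2 * s / c) ^ (1 / (k : ℝ)) with hη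
  have hηpos : 0 < η := by positivity
  have hS : IsClosed (Metric.closedBall p0 R ∩ {p | |dd φ [v] p + b| ≤ s}) :=
    Metric.isClosed_closedBall.inter (isClosed_le (by fun_prop) continuous_const)
  have hpow : (2 / η) ^ k * s = c / 2 := by
    have : (2 / η) ^ k = c / (2 * s) := by
      have h1 : 2 / η = ((2 * s / c) ^ (1 / (k : ℝ)))⁻¹ := by
        rw [hη]; field_simp
      rw [h1, inv_pow, ← Real.rpow_natCast, ← Real.rpow_mul (by positivity), one_div_mul_cancel hk0,
        Real.rpow_one, inv_div]
    rw [this]; field_simp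
  have key := average μ _ hS p0 v R Set.inter_subset_left (ENNReal.ofReal (2 ^ k * η)) (by
    intro p
    let I : Set ℝ := Set.Icc (0:ℝ) 1 ∩ {t | p + t • v ∈ Metric.closedBall p0 R}
    let F : ℕ → ℝ → ℝ := fun j t => dd φ (List.replicate (j + 1) v) (p + t • v) + (if j = 0 then b else 0)
    have hF : ∀ j t, HasDerivAt (F j) (F (j + 1) t) t := by
      intro j t
      have := (dd_line φ hφ (List.replicate (j + 1) v) p v t).add_const (if j = 0 then b else 0)
      simpa [F, List.replicate_succ] using this
    have hcl : IsClosed {t : ℝ | p + t • v ∈ Metric.closedBall p0 R} :=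
      Metric.isClosed_closedBall.preimage (by fun_prop)
    have hconv : Convex ℝ {t : ℝ | p + t • v ∈ Metric.closedBall p0 R} := by
      have : {t : ℝ | p + t • v ∈ Metric.closedBall p0 R}
        = (AffineMap.lineMap p (p + v) : ℝ →ᵃ[ℝ] V) ⁻¹' (Metric.closedBall p0 R) := by
        ext t
        simp [AffineMap.lineMap_apply, add_comm]
      rw [this]
      exact (convex_closedBall p0 R).affine_preimage _
    have hI : I.OrdConnected := ((convex_Icc 0 1).inter hconv).ordConnected
    have hIc : IsCompact I := isCompact_Icc.inter_right hcl
    refine le_trans (measure_mono ?_) (sublevel1 k F hF I hI hIc c s η hηpos ?_ ?_)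
    · rintro t ⟨h1, h2, h3⟩
      exact ⟨⟨h1, h2⟩, by simpa [F] using h3⟩
    · intro t ht
      have := hc _ ht.2
      have hk' : k ≠ 0 := by omega
      simpa [F, hk'] using this
    · rw [hpow]; linarith)
  have hfin : μ (Metric.closedBall p0 (R + ‖v‖)) ≠ ⊤ := (isCompact_closedBall _ _).measure_lt_top.ne
  have := ENNReal.toReal_mono (ENNReal.mul_ne_top ENNReal.ofReal_ne_top hfin) key
  rw [ENNReal.toReal_mul, ENNReal.toReal_ofReal (by positivity)] at this
  refine this.trans (le_of_eq ?_)
  have h5 : (2 * s / c) ^ (1 / (k : ℝ)) = (2 / c) ^ (1 / (k : ℝ)) * s ^ (1 / (k : ℝ)) := by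
    rw [← Real.mul_rpow (by positivity) hs.le]; congr 1; ring
  rw [hη, h5, Measure.real]
  ring

/-- The basic algebraic decomposition and integration by parts. -/
lemma ibp_bound {V : Type*} [NormedAddCommGroup V] [NormedSpace ℝ V] [FiniteDimensional ℝ V]
    [MeasurableSpace V] [BorelSpace V] (μ : Measure V) [μ.IsAddHaarMeasure]
    (φ : V → ℝ) (hφ : ContDiff ℝ (⊤ : ℕ∞) φ) (p0 v : V) (R M : ℝ) (hM0 : 0 ≤ M)
    (hM : ∀ p ∈ Metric.closedBall p0 R, |dd φ [v, v] p| ≤ M)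
    (a : V → ℂ) (ha : ContDiff ℝ 1 a) (hsupp : tsupport a ⊆ Metric.closedBall p0 R)
    (A B : ℝ) (hA : ∀ p, ‖a p‖ ≤ A) (hB : ∀ p, ‖fderiv ℝ a p‖ ≤ B)
    (lam : ℝ) (hlam : 1 ≤ lam) (L : V →L[ℝ] ℝ) (s : ℝ) (hs : 0 < s) :
    ‖∫ p, Complex.exp (Complex.I * ((L p + lam * φ p : ℝ) : ℂ)) * a p ∂μ‖ ≤
      A * (1 + M) * μ.real (Metric.closedBall p0 R ∩ {p | |dd φ [v] p + L v / lam| ≤ s})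
      + (A * (1 + M) * (1 / (lam * s ^ 2)) + B * ‖v‖ * lam ^ (-(1 : ℝ) / 2)) *
        μ.real (Metric.closedBall p0 R) := by
  have hl0 : 0 < lam := by linarith
  set ψ : V → ℝ := fun p => L p + lam * φ p with hψ
  set h : V → ℝ := fun p => dd φ [v] p + L v / lam with hh
  set q : V → ℝ := fun p => h p / (h p ^ 2 + 1 / lam) with hq
  have hden : ∀ p, 0 < h p ^ 2 + 1 / lam := fun p => by positivity
  have hψs : ContDiff ℝ 1 ψ := by
    have : ContDiff ℝ 1 φ := hφ.of_le (by exact_mod_cast le_top)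
    fun_prop
  have hhs : ContDiff ℝ 1 h := by
    have : ContDiff ℝ 1 (dd φ [v]) := (dd_smooth φ hφ [v]).of_le (by exact_mod_cast le_top)
    fun_prop
  have hqs : ContDiff ℝ 1 q := hhs.div (by fun_prop) (fun p => (hden p).ne')
  set e : V → ℂ := fun p => Complex.exp (Complex.I * ((ψ p : ℝ) : ℂ)) with he
  have hofR : ∀ f : V → ℝ, ContDiff ℝ 1 f → ContDiff ℝ 1 (fun p => ((f p : ℝ) : ℂ)) :=
    fun f hf => Complex.ofRealCLM.contDiff.comp hf
  have hes : ContDiff ℝ 1 e := (contDiff_const.mul (hofR ψ hψs)).cexp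
  set F : V → ℂ := fun p => e p * a p * ((q p : ℝ) : ℂ) with hF
  have hFs : ContDiff ℝ 1 F := (hes.mul ha).mul (hofR q hqs)
  have hac : HasCompactSupport a :=
    (isCompact_closedBall p0 R).of_isClosed_subset (isClosed_tsupport a) hsupp
  have hFc : HasCompactSupport F := (hac.mul_left).mul_right
  have hFder : Continuous (fun p => fderiv ℝ F p v) :=
    (hFs.continuous_fderiv (by simp)).clm_apply continuous_const
  have hFdc : HasCompactSupport (fun p => fderiv ℝ F p v) := hFc.fderiv_apply ℝ v
  have hFint : Integrable (fun p => fderiv ℝ F p v) μ := hFder.integrable_of_hasCompactSupport hFdc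
  have hzero : ∫ p, fderiv ℝ F p v ∂μ = 0 := by
    have := integral_mul_fderiv_eq_neg_fderiv_mul_of_integrable (μ := μ) (f := fun _ : V => (1:ℂ)) (g := F) (v := v)
      (by simp) (by simpa using hFint)
      (by simpa using hFs.continuous.integrable_of_hasCompactSupport hFc)
      (fun x _ => differentiableAt_const _) (fun x _ => hFs.differentiable (by simp) x)
    simpa using this
  have hea : Integrable (fun p => e p * a p) μ :=
    (hes.continuous.mul ha.continuous).integrable_of_hasCompactSupport hac.mul_left
  have hsplit : ∫ p, e p * a p ∂μ = ∫ p, (e p * a p - (Complex.I * lam)⁻¹ * fderiv ℝ F p v) ∂μ := by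
    rw [integral_sub hea (hFint.const_mul _), integral_const_mul, hzero]; simp
  change ‖∫ p, e p * a p ∂μ‖ ≤ _
  rw [hsplit]
  set w : V → ℝ := fun p => 1 / (lam * h p ^ 2 + 1) with hw
  have hderiv : ∀ p, fderiv ℝ F p v = e p * (Complex.I * lam * (1 - w p : ℝ) * a p + fderiv ℝ a p v * q p
      + a p * ((dd φ [v, v] p * (1 / lam - h p ^ 2) / (h p ^ 2 + 1 / lam) ^ 2 : ℝ) : ℂ)) := by
    intro p
    have line : ∀ f : V → ℂ, ContDiff ℝ 1 f → HasDerivAt (fun t : ℝ => f (p + t • v)) (fderiv ℝ f p v) 0 := by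
      intro f hf
      have h1 : HasFDerivAt f (fderiv ℝ f p) (p + (0:ℝ) • v) := by
        simpa using (hf.differentiable (by simp) p).hasFDerivAt
      have h2 : HasDerivAt (fun t : ℝ => p + t • v) v 0 := by
        simpa using ((hasDerivAt_id (0:ℝ)).smul_const v).const_add p
      exact h1.comp_hasDerivAt 0 h2
    have dh : HasDerivAt (fun t : ℝ => h (p + t • v)) (dd φ [v, v] p) 0 := by
      simpa [hh] using (dd_line φ hφ [v] p v 0).add_const (L v / lam)
    have dψ : HasDerivAt (fun t : ℝ => ψ (p + t • v)) (lam * h p) 0 := by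
      have h1 := (dd_line φ hφ [] p v 0).const_mul lam
      have h2 : HasDerivAt (fun t : ℝ => L (p + t • v)) (L v) 0 := by
        have : HasDerivAt (fun t : ℝ => p + t • v) v 0 := by
          simpa using ((hasDerivAt_id (0:ℝ)).smul_const v).const_add p
        exact L.hasFDerivAt.comp_hasDerivAt 0 this
      have h3 := h2.add h1
      refine h3.congr_deriv ?_
      simp [hh]
      field_simp
      ring
    have dq : HasDerivAt (fun t : ℝ => q (p + t • v))
        (dd φ [v, v] p * (1 / lam - h p ^ 2) / (h p ^ 2 + 1 / lam) ^ 2) 0 := by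
      have := dh.div ((dh.pow 2).add_const (1 / lam)) (by simpa using (hden p).ne')
      refine this.congr_deriv ?_
      simp
      ring
    have de : HasDerivAt (fun t : ℝ => e (p + t • v)) (e p * (Complex.I * ((lam * h p : ℝ) : ℂ))) 0 := by
      have := (dψ.ofReal_comp.const_mul Complex.I).cexp
      simpa [he] using this
    have dF := ((de.mul (line a ha)).mul dq.ofReal_comp)
    have := (line F hFs).unique dF
    rw [this]
    simp only [zero_smul, add_zero, Pi.mul_apply]
    have hwq : ((1 - w p : ℝ) : ℂ) = ((h p * q p : ℝ) : ℂ) := by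
      congr 1
      simp only [hw, hq]
      have := hden p
      have h2 : lam * h p ^ 2 + 1 ≠ 0 := by positivity
      field_simp
      ring
    rw [hwq]
    push_cast
    ring
  have hA0 : 0 ≤ A := (norm_nonneg _).trans (hA p0)
  have hB0 : 0 ≤ B := (norm_nonneg _).trans (hB p0)
  set T : Set V := Metric.closedBall p0 R ∩ {p | |dd φ [v] p + L v / lam| ≤ s} with hT
  have hTm : MeasurableSet T :=
    (Metric.isClosed_closedBall.inter (isClosed_le (by
      have : Continuous (dd φ [v]) := (dd_smooth φ hφ [v]).continuous
      fun_prop) continuous_const)).measurableSet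
  have hKm : MeasurableSet (Metric.closedBall p0 R) := Metric.isClosed_closedBall.measurableSet
  set c1 : ℝ := A * (1 + M)
  set c2 : ℝ := A * (1 + M) * (1 / (lam * s ^ 2)) + B * ‖v‖ * lam ^ (-(1 : ℝ) / 2)
  have hKfin : μ (Metric.closedBall p0 R) ≠ ⊤ := (isCompact_closedBall _ _).measure_lt_top.ne
  have hTfin : μ T ≠ ⊤ := ne_top_of_le_ne_top hKfin (measure_mono Set.inter_subset_left)
  have hpt : ∀ p, ‖e p * a p - (Complex.I * lam)⁻¹ * fderiv ℝ F p v‖ ≤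
      T.indicator (fun _ => c1) p + (Metric.closedBall p0 R).indicator (fun _ => c2) p := by
    intro p
    by_cases hp : p ∈ Metric.closedBall p0 R
    · have hne : (Complex.I * (lam : ℂ)) ≠ 0 := by
        simp [hl0.ne']
      have e1 : e p * a p - (Complex.I * lam)⁻¹ * fderiv ℝ F p v
          = e p * ((w p : ℝ) * a p - (Complex.I * lam)⁻¹ * (fderiv ℝ a p v * q p
      + a p * ((dd φ [v, v] p * (1 / lam - h p ^ 2) / (h p ^ 2 + 1 / lam) ^ 2 : ℝ) : ℂ))) := by
        have hinv := inv_mul_cancel₀ hne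
        rw [hderiv, Complex.ofReal_sub, Complex.ofReal_one]
        linear_combination (-(e p * a p * (1 - (w p : ℂ)))) * hinv
      have hen : ‖e p‖ = 1 := by
        simp only [he]
        rw [mul_comm]; exact Complex.norm_exp_ofReal_mul_I _
      have hw0 : 0 ≤ w p := by simp only [hw]; positivity
      have hqb : |q p| ≤ lam * lam ^ (-(1 : ℝ) / 2) := by
        have hsq : lam ^ (-(1 : ℝ) / 2) * lam ^ (-(1 : ℝ) / 2) = 1 / lam := by
          rw [← Real.rpow_add hl0]; norm_num [Real.rpow_neg_one]
        set r := lam ^ (-(1 : ℝ) / 2) with hr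
        have hr0 : 0 < r := by positivity
        have : lam * r = 1 / r := by
          field_simp
          rw [pow_two, hsq]; field_simp
        simp only [hq]
        rw [this, abs_div, abs_of_pos (hden p), div_le_div_iff₀ (hden p) hr0, ← hsq]
        have h3 : h p ^ 2 = |h p| ^ 2 := (sq_abs _).symm
        rw [h3]
        nlinarith [sq_nonneg (|h p| - r), abs_nonneg (h p)]
      have hq'b : |dd φ [v, v] p * (1 / lam - h p ^ 2) / (h p ^ 2 + 1 / lam) ^ 2| ≤ M * (lam * w p) := by
        have h4 : lam * w p = 1 / (h p ^ 2 + 1 / lam) := by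
          simp only [hw]
          have := hden p
          have h2 : lam * h p ^ 2 + 1 ≠ 0 := by positivity
          field_simp
        rw [h4, abs_div, abs_mul, abs_of_pos (pow_pos (hden p) 2), mul_div_assoc]
        refine mul_le_mul (hM p hp) ?_ (by positivity) hM0
        rw [div_le_div_iff₀ (pow_pos (hden p) 2) (hden p), one_mul, pow_two (h p ^ 2 + 1 / lam)]
        refine mul_le_mul_of_nonneg_right ?_ (hden p).le
        rw [abs_le]
        have : 0 < 1 / lam := by positivity
        constructor <;> nlinarith [sq_nonneg (h p)]
      have hav : ‖fderiv ℝ a p v‖ ≤ B * ‖v‖ := (ContinuousLinearMap.le_opNorm _ _).trans (by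
        gcongr; exact hB p)
      have main : ‖e p * a p - (Complex.I * lam)⁻¹ * fderiv ℝ F p v‖ ≤
          c1 * w p + B * ‖v‖ * lam ^ (-(1 : ℝ) / 2) := by
        rw [e1, norm_mul, hen, one_mul]
        refine (norm_sub_le _ _).trans ?_
        rw [norm_mul, norm_mul, norm_inv, norm_mul, Complex.norm_I, one_mul, Complex.norm_real,
          Complex.norm_real, Real.norm_eq_abs, Real.norm_eq_abs, abs_of_nonneg hw0, abs_of_pos hl0]
        have i1 : w p * ‖a p‖ ≤ w p * A := by gcongr; exact hA p
        have i2 : ‖fderiv ℝ a p v * q p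
            + a p * ((dd φ [v, v] p * (1 / lam - h p ^ 2) / (h p ^ 2 + 1 / lam) ^ 2 : ℝ) : ℂ)‖ ≤
            (B * ‖v‖) * (lam * lam ^ (-(1 : ℝ) / 2)) + A * (M * (lam * w p)) := by
          refine (norm_add_le _ _).trans ?_
          rw [norm_mul, norm_mul, Complex.norm_real, Complex.norm_real, Real.norm_eq_abs, Real.norm_eq_abs]
          have := hA p
          gcongr
        have i3 : lam⁻¹ * ((B * ‖v‖) * (lam * lam ^ (-(1 : ℝ) / 2)) + A * (M * (lam * w p)))
            = B * ‖v‖ * lam ^ (-(1 : ℝ) / 2) + A * M * w p := by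
          field_simp
        have i4 : lam⁻¹ * ‖fderiv ℝ a p v * q p
            + a p * ((dd φ [v, v] p * (1 / lam - h p ^ 2) / (h p ^ 2 + 1 / lam) ^ 2 : ℝ) : ℂ)‖ ≤
            B * ‖v‖ * lam ^ (-(1 : ℝ) / 2) + A * M * w p := by
          rw [← i3]; gcongr
        have : c1 * w p = w p * A + A * M * w p := by simp only [c1]; ring
        linarith
      refine main.trans ?_
      rw [Set.indicator_of_mem hp]
      have hc1 : 0 ≤ c1 := by positivity
      by_cases hpT : p ∈ T
      · rw [Set.indicator_of_mem hpT]
        have : w p ≤ 1 := by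
          simp only [hw]
          rw [div_le_one (by positivity)]
          nlinarith [sq_nonneg (h p)]
        have h5 : c1 * w p ≤ c1 := mul_le_of_le_one_right hc1 this
        have h6 : 0 ≤ A * (1 + M) * (1 / (lam * s ^ 2)) := by positivity
        simp only [c2]
        linarith
      · rw [Set.indicator_of_notMem hpT]
        have hgt : s < |h p| := by
          by_contra hcon
          exact hpT ⟨hp, not_lt.mp hcon⟩
        have : w p ≤ 1 / (lam * s ^ 2) := by
          simp only [hw]
          apply one_div_le_one_div_of_le (by positivity)
          have h7 : s ^ 2 ≤ h p ^ 2 := by rw [← sq_abs (h p)]; gcongr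
          nlinarith
        have h5 : c1 * w p ≤ c1 * (1 / (lam * s ^ 2)) := by gcongr
        simp only [c2]
        simp only [c1] at h5 ⊢
        linarith
    · have ha0 : a p = 0 := image_eq_zero_of_notMem_tsupport fun hh => hp (hsupp hh)
      have hda : fderiv ℝ a p = 0 := by
        by_contra hcon
        exact hp (hsupp (tsupport_fderiv_subset ℝ (subset_tsupport _ hcon)))
      have hpT : p ∉ T := fun hh => hp hh.1
      rw [Set.indicator_of_notMem hp, Set.indicator_of_notMem hpT, hderiv, ha0, hda]
      simp
  have hintegr : Integrable (fun p => T.indicator (fun _ => c1) p + (Metric.closedBall p0 R).indicator (fun _ => c2) p) μ := by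
    refine Integrable.add ?_ ?_
    · exact (integrable_indicator_iff hTm).mpr (integrableOn_const hTfin)
    · exact (integrable_indicator_iff hKm).mpr (integrableOn_const hKfin)
  refine (norm_integral_le_of_norm_le hintegr (Eventually.of_forall hpt)).trans (le_of_eq ?_)
  rw [integral_add ((integrable_indicator_iff hTm).mpr (integrableOn_const hTfin))
    ((integrable_indicator_iff hKm).mpr (integrableOn_const hKfin)), integral_indicator hTm, integral_indicator hKm]
  simp
  ring

lemma local_osc {V : Type*} [NormedAddCommGroup V] [NormedSpace ℝ V] [FiniteDimensional ℝ V]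
    [MeasurableSpace V] [BorelSpace V] (μ : Measure V) [μ.IsAddHaarMeasure]
    (φ : V → ℝ) (hφ : ContDiff ℝ (⊤ : ℕ∞) φ) (n : ℕ) (hn : 2 ≤ n) (p0 : V) (vs : Fin n → V)
    (hne : iteratedFDeriv ℝ n φ p0 vs ≠ 0) :
    ∃ R : ℝ, 0 < R ∧ ∃ C : ℝ, 0 ≤ C ∧ ∀ (a : V → ℂ) (_ : ContDiff ℝ 1 a)
      (_ : tsupport a ⊆ Metric.ball p0 R) (A B : ℝ) (_ : ∀ p, ‖a p‖ ≤ A) (_ : ∀ p, ‖fderiv ℝ a p‖ ≤ B)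
      (lam : ℝ) (_ : 1 ≤ lam) (L : V →L[ℝ] ℝ),
      ‖∫ p, Complex.exp (Complex.I * ((L p + lam * φ p : ℝ) : ℂ)) * a p ∂μ‖ ≤
        C * (A * lam ^ (-(1 : ℝ) / (2 * n)) + B * lam ^ (-(1 : ℝ) / 2)) := by
  obtain ⟨v, hv⟩ := pol φ hφ p0 vs hne
  obtain ⟨k, rfl⟩ : ∃ k, n = k + 1 := ⟨n - 1, by omega⟩
  have hk : 1 ≤ k := by omega
  set c : ℝ := |dd φ (List.replicate (k + 1) v) p0| / 2 with hc
  have hc0 : 0 < c := by positivity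
  have hcont : Continuous fun p => |dd φ (List.replicate (k + 1) v) p| :=
    (dd_smooth φ hφ _).continuous.abs
  have hev : ∀ᶠ p in nhds p0, c < |dd φ (List.replicate (k + 1) v) p| :=
    hcont.continuousAt.eventually_const_lt (by rw [hc]; linarith)
  obtain ⟨R, hR, hRsub⟩ := Metric.nhds_basis_closedBall.eventually_iff.mp hev
  obtain ⟨M, hM⟩ := (isCompact_closedBall p0 R).exists_bound_of_continuousOn
    (dd_smooth φ hφ [v, v]).continuous.continuousOn
  have hM0 : 0 ≤ M := (norm_nonneg _).trans (hM p0 (Metric.mem_closedBall_self hR.le))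
  obtain ⟨C0, hC0, hsub⟩ := sublevelV μ φ hφ k hk p0 v R c hc0 (fun p hp => (hRsub hp).le)
  set K : ℝ := μ.real (Metric.closedBall p0 R) with hK
  have hK0 : 0 ≤ K := measureReal_nonneg
  refine ⟨R, hR, (1 + M) * C0 + (1 + M) * K + ‖v‖ * K, by positivity, ?_⟩
  intro a ha hsupp A B hA hB lam hlam L
  have hl0 : 0 < lam := by linarith
  have hA0 : 0 ≤ A := (norm_nonneg _).trans (hA p0)
  have hB0 : 0 ≤ B := (norm_nonneg _).trans (hB p0)
  set s : ℝ := lam ^ (-(k : ℝ) / (2 * (k + 1))) with hs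
  have hs0 : 0 < s := by positivity
  have hk0 : (k : ℝ) ≠ 0 := by positivity
  have main := ibp_bound μ φ hφ p0 v R M hM0 hM a ha (hsupp.trans Metric.ball_subset_closedBall) A B hA hB
    lam hlam L s hs0
  refine main.trans ?_
  set X : ℝ := lam ^ (-(1 : ℝ) / (2 * ((k + 1 : ℕ) : ℝ))) with hX
  set Y : ℝ := lam ^ (-(1 : ℝ) / 2) with hY
  have hX0 : 0 < X := by positivity
  have hY0 : 0 < Y := by positivity
  have e1 : s ^ (1 / (k : ℝ)) = X := by
    rw [hs, hX, ← Real.rpow_mul hl0.le]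
    congr 1
    push_cast
    field_simp
  have e2 : 1 / (lam * s ^ 2) ≤ X := by
    have : 1 / (lam * s ^ 2) = lam ^ (-(1 : ℝ) / (k + 1)) := by
      rw [hs, ← Real.rpow_natCast, ← Real.rpow_mul hl0.le, ← Real.rpow_one_add' hl0.le, one_div, ← Real.rpow_neg hl0.le]
      · congr 1
        push_cast
        field_simp
        ring
      · push_cast
        have : (1 : ℝ) + -k / (2 * (k + 1)) * 2 = 1 / (k + 1) := by field_simp; ring
        rw [this]
        positivity
    rw [this, hX]
    apply Real.rpow_le_rpow_of_exponent_le hlam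
    push_cast
    rw [neg_div, neg_div, neg_le_neg_iff]
    apply one_div_le_one_div_of_le (by positivity)
    linarith [show (0:ℝ) ≤ k from Nat.cast_nonneg k]
  have e3 := hsub s hs0 (L v / lam)
  rw [e1] at e3
  calc _ ≤ A * (1 + M) * (C0 * X) + (A * (1 + M) * X + B * ‖v‖ * Y) * K := by gcongr
    _ ≤ _ := by
      have t1 : 0 ≤ (1 + M) * C0 * (B * Y) := by positivity
      have t2 : 0 ≤ (1 + M) * K * (B * Y) := by positivity
      have t3 : 0 ≤ ‖v‖ * K * (A * X) := by positivity
      nlinarith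

lemma cut_off {V : Type*} [NormedAddCommGroup V] [NormedSpace ℝ V] [FiniteDimensional ℝ V]
    (m : V → ℂ) (hm : ∀ p, p ≠ 0 → ContDiffAt ℝ 1 m p) (A C1 : ℝ) (hA : ∀ p, ‖m p‖ ≤ A)
    (hC1 : ∀ p, p ≠ 0 → ‖fderiv ℝ m p‖ * ‖p‖ ≤ C1) :
    ∃ C : ℝ, 0 ≤ C ∧ ∀ r : ℝ, 0 < r → ∃ b : V → ℂ, ContDiff ℝ 1 b ∧ tsupport b ⊆ tsupport m ∧
      (∀ p, ‖b p‖ ≤ A) ∧ (∀ p, ‖fderiv ℝ b p‖ ≤ C / r) ∧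
      (∀ p, ‖m p - b p‖ ≤ (Metric.closedBall (0 : V) (2 * r)).indicator (fun _ => A) p) := by
  let κ : ContDiffBump (0 : V) := ⟨1, 2, by norm_num, by norm_num⟩
  have hκs : ContDiff ℝ 1 κ := κ.contDiff
  obtain ⟨D, hD⟩ := (hκs.continuous_fderiv (by simp)).bounded_above_of_compact_support
    (κ.hasCompactSupport.fderiv ℝ)
  have hA0 : 0 ≤ A := (norm_nonneg _).trans (hA 0)
  have hD0 : 0 ≤ D := (norm_nonneg _).trans (hD 0)
  refine ⟨|C1| + D * A, by positivity, fun r hr => ?_⟩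
  set g : V → ℝ := fun p => 1 - κ (r⁻¹ • p) with hg
  have hgs : ContDiff ℝ 1 g := contDiff_const.sub (hκs.comp (contDiff_const.smul contDiff_id))
  have hg01 : ∀ p, 0 ≤ g p ∧ g p ≤ 1 := fun p =>
    ⟨by simp only [hg]; linarith [κ.le_one (x := r⁻¹ • p)], by simp only [hg]; linarith [κ.nonneg (x := r⁻¹ • p)]⟩
  have hgn : ∀ p, ‖g p‖ ≤ 1 := fun p => by
    rw [Real.norm_eq_abs, abs_of_nonneg (hg01 p).1]; exact (hg01 p).2
  have hgder : ∀ p, ‖fderiv ℝ g p‖ ≤ D / r := by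
    intro p
    have h1 : HasFDerivAt (fun p : V => r⁻¹ • p) (r⁻¹ • ContinuousLinearMap.id ℝ V) p :=
      (hasFDerivAt_id p).const_smul r⁻¹
    have h2 := ((hκs.differentiable (by simp) (r⁻¹ • p)).hasFDerivAt.comp p h1).const_sub 1
    have h3 : HasFDerivAt g _ p := h2
    rw [h3.fderiv, norm_neg, ContinuousLinearMap.comp_smul, ContinuousLinearMap.comp_id, norm_smul,
      norm_inv, Real.norm_eq_abs, abs_of_pos hr, inv_mul_eq_div]
    gcongr
    exact hD _
  have hgz : ∀ p, ‖p‖ ≤ r → g p = 0 := by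
    intro p hp
    have : κ (r⁻¹ • p) = 1 := κ.one_of_mem_closedBall (by
      change _ ∈ Metric.closedBall _ 1
      rw [mem_closedBall_zero_iff, norm_smul, norm_inv, Real.norm_eq_abs, abs_of_pos hr, inv_mul_eq_div,
        div_le_one hr]
      exact hp)
    simp [hg, this]
  set b : V → ℂ := fun p => g p • m p with hb
  have hbz : ∀ p, ‖p‖ < r → b =ᶠ[nhds p] fun _ => 0 := by
    intro p hp
    filter_upwards [Metric.isOpen_ball.mem_nhds (show p ∈ Metric.ball (0:V) r by simpa using hp)] with q hq
    simp only [hb]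
    rw [hgz q (by simpa using (le_of_lt (mem_ball_zero_iff.mp hq))), zero_smul]
  refine ⟨b, ?_, ?_, ?_, ?_, ?_⟩
  · rw [contDiff_iff_contDiffAt]
    intro p
    by_cases hp : p = 0
    · exact (contDiffAt_const (c := (0:ℂ))).congr_of_eventuallyEq (hbz p (by simpa [hp] using hr))
    · exact hgs.contDiffAt.smul (hm p hp)
  · exact closure_mono (Function.support_smul_subset_right g m)
  · intro p
    simp only [hb]
    rw [norm_smul]
    exact (mul_le_of_le_one_left (norm_nonneg _) (hgn p)).trans (hA p)
  · intro p
    rcases lt_or_ge ‖p‖ r with hp | hp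
    · rw [(hbz p hp).fderiv_eq]
      simp
      positivity
    · have hp0 : p ≠ 0 := by
        rintro rfl
        simp at hp
        linarith
      have h1 : HasFDerivAt b _ p := (hgs.differentiable (by simp) p).hasFDerivAt.smul
        ((hm p hp0).differentiableAt (by simp)).hasFDerivAt
      rw [h1.fderiv]
      refine (norm_add_le _ _).trans ?_
      rw [norm_smul, ContinuousLinearMap.norm_smulRight_apply]
      have h2 : ‖fderiv ℝ m p‖ ≤ |C1| / r := by
        rw [le_div_iff₀ hr]
        refine le_trans ?_ ((hC1 p hp0).trans (le_abs_self _))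
        gcongr
      have h3 : ‖g p‖ * ‖fderiv ℝ m p‖ ≤ |C1| / r :=
        (mul_le_of_le_one_left (norm_nonneg _) (hgn p)).trans h2
      have h4 : ‖fderiv ℝ g p‖ * ‖m p‖ ≤ D / r * A := by
        have := hgder p
        have := hA p
        gcongr
      have : (|C1| + D * A) / r = |C1| / r + D / r * A := by ring
      rw [this]
      linarith
  · intro p
    by_cases hp : p ∈ Metric.closedBall (0 : V) (2 * r)
    · rw [Set.indicator_of_mem hp]
      have : m p - b p = (1 - g p) • m p := by rw [sub_smul (1:ℝ) (g p), one_smul]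
      rw [this, norm_smul]
      refine (mul_le_of_le_one_left (norm_nonneg _) ?_).trans (hA p)
      rw [Real.norm_eq_abs, abs_of_nonneg (by linarith [(hg01 p).2])]
      linarith [(hg01 p).1]
    · rw [Set.indicator_of_notMem hp]
      have : κ (r⁻¹ • p) = 0 := κ.zero_of_le_dist (by
        change 2 ≤ _
        rw [mem_closedBall_zero_iff, not_le] at hp
        rw [dist_zero_right, norm_smul, norm_inv, Real.norm_eq_abs, abs_of_pos hr, inv_mul_eq_div,
          le_div_iff₀ hr]
        exact hp.le)
      simp [hb, hg, this]

set_option maxHeartbeats 1000000 in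
lemma global_osc {V : Type*} [NormedAddCommGroup V] [NormedSpace ℝ V] [FiniteDimensional ℝ V] [Nontrivial V]
    [MeasurableSpace V] [BorelSpace V] (μ : Measure V) [μ.IsAddHaarMeasure]
    (φ : V → ℝ) (hφ : ContDiff ℝ (⊤ : ℕ∞) φ) (n : ℕ) (hn : 2 ≤ n) (vs : Fin n → V)
    (m : V → ℂ) (hmc : HasCompactSupport m) (hm : ∀ p, p ≠ 0 → ContDiffAt ℝ 1 m p) (hmint : Integrable m μ)
    (A C1 : ℝ) (hA : ∀ p, ‖m p‖ ≤ A)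
    (hC1 : ∀ p, p ≠ 0 → ‖fderiv ℝ m p‖ * ‖p‖ ≤ C1)
    (hne : ∀ p ∈ tsupport m, iteratedFDeriv ℝ n φ p vs ≠ 0) :
    ∃ C : ℝ, 0 ≤ C ∧ ∀ (lam : ℝ) (_ : 1 ≤ lam) (L : V →L[ℝ] ℝ),
      ‖∫ p, Complex.exp (Complex.I * ((L p + lam * φ p : ℝ) : ℂ)) * m p ∂μ‖ ≤
        C * lam ^ (-(1 : ℝ) / (2 * n)) := by
  have hA0 : 0 ≤ A := (norm_nonneg _).trans (hA 0)
  have hloc : ∀ p0 : V, ∃ R : ℝ, 0 < R ∧ ∃ C : ℝ, 0 ≤ C ∧ (p0 ∈ tsupport m → ∀ (a : V → ℂ) (_ : ContDiff ℝ 1 a)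
      (_ : tsupport a ⊆ Metric.ball p0 R) (A B : ℝ) (_ : ∀ p, ‖a p‖ ≤ A) (_ : ∀ p, ‖fderiv ℝ a p‖ ≤ B)
      (lam : ℝ) (_ : 1 ≤ lam) (L : V →L[ℝ] ℝ),
      ‖∫ p, Complex.exp (Complex.I * ((L p + lam * φ p : ℝ) : ℂ)) * a p ∂μ‖ ≤
        C * (A * lam ^ (-(1 : ℝ) / (2 * n)) + B * lam ^ (-(1 : ℝ) / 2))) := by
    intro p0
    by_cases hp : p0 ∈ tsupport m
    · obtain ⟨R, hR, C, hC, h⟩ := local_osc μ φ hφ n hn p0 vs (hne p0 hp)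
      exact ⟨R, hR, C, hC, fun _ => h⟩
    · exact ⟨1, one_pos, 0, le_rfl, fun h => absurd h hp⟩
  choose R hR C hC hbd using hloc
  obtain ⟨t, htK, htcov⟩ := hmc.isCompact.elim_nhds_subcover (fun p => Metric.ball p (R p))
    (fun p _ => Metric.ball_mem_nhds p (hR p))
  obtain ⟨ρ, hρ⟩ := SmoothPartitionOfUnity.exists_isSubordinate (modelWithCornersSelf ℝ V)
    (isClosed_tsupport m) (fun i : t => Metric.ball (i : V) (R i)) (fun i => Metric.isOpen_ball)
    (by
      intro x hx
      have := htcov hx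
      simp only [Set.mem_iUnion] at this ⊢
      obtain ⟨i, hi, h⟩ := this
      exact ⟨⟨i, hi⟩, h⟩)
  have hρs : ∀ i : t, ContDiff ℝ 1 (ρ i) := fun i => ((ρ i).contMDiff.contDiff).of_le (by exact_mod_cast le_top)
  have hρc : ∀ i : t, HasCompactSupport (ρ i) := fun i =>
    (isCompact_closedBall (i : V) (R i)).of_isClosed_subset (isClosed_tsupport _)
      ((hρ i).trans Metric.ball_subset_closedBall)
  have hD : ∀ i : t, ∃ D, ∀ p, ‖fderiv ℝ (ρ i) p‖ ≤ D := fun i =>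
    ((hρs i).continuous_fderiv (by simp)).bounded_above_of_compact_support ((hρc i).fderiv ℝ)
  choose D hD using hD
  have hD0 : ∀ i, 0 ≤ D i := fun i => (norm_nonneg _).trans (hD i 0)
  obtain ⟨C2, hC2, hcut⟩ := cut_off m hm A C1 hA hC1
  set C3 : ℝ := A * (2 ^ Module.finrank ℝ V * μ.real (Metric.ball (0:V) 1)) with hC3
  refine ⟨C3 + ∑ i : t, C (i : V) * (A + (D i * A + C2)), ?_, ?_⟩
  · have : ∀ i : t, 0 ≤ C (i : V) * (A + (D i * A + C2)) := fun i => by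
      have := hC (i : V); have := hD0 i; positivity
    have h2 := Finset.sum_nonneg (fun (i : t) (_ : i ∈ Finset.univ) => this i)
    positivity
  intro lam hlam L
  have hl0 : 0 < lam := by linarith
  set r : ℝ := lam ^ (-(1 : ℝ) / (2 * n)) with hr
  have hr0 : 0 < r := by positivity
  have hr1 : r ≤ 1 := Real.rpow_le_one_of_one_le_of_nonpos hlam (by
    rw [neg_div, neg_nonpos]; positivity)
  obtain ⟨b, hbs, hbsupp, hbA, hbD, hmb⟩ := hcut r hr0
  set e : V → ℂ := fun p => Complex.exp (Complex.I * ((L p + lam * φ p : ℝ) : ℂ)) with he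
  have hecont : Continuous e := by
    have := hφ.continuous
    simp only [he]
    fun_prop
  have hen : ∀ p, ‖e p‖ = 1 := fun p => by
    simp only [he]; rw [mul_comm]; exact Complex.norm_exp_ofReal_mul_I _
  have hbc : HasCompactSupport b := hmc.of_isClosed_subset (isClosed_tsupport b) hbsupp
  have hbint : Integrable b μ := hbs.continuous.integrable_of_hasCompactSupport hbc
  have hmul : ∀ f : V → ℂ, Integrable f μ → Integrable (fun p => e p * f p) μ := fun f hf =>
    hf.bdd_mul hecont.aestronglyMeasurable (Eventually.of_forall fun p => (hen p).le)
  have hsplit : ∫ p, e p * m p ∂μ = ∫ p, e p * (m p - b p) ∂μ + ∫ p, e p * b p ∂μ := by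
    rw [← integral_add (hmul (fun p => m p - b p) (hmint.sub hbint)) (hmul b hbint)]
    congr 1; funext p; ring
  have hKm : MeasurableSet (Metric.closedBall (0:V) (2 * r)) := Metric.isClosed_closedBall.measurableSet
  have hKfin : μ (Metric.closedBall (0:V) (2 * r)) ≠ ⊤ := (isCompact_closedBall _ _).measure_lt_top.ne
  have part1 : ‖∫ p, e p * (m p - b p) ∂μ‖ ≤ C3 * r := by
    refine (norm_integral_le_of_norm_le (g := (Metric.closedBall (0 : V) (2 * r)).indicator (fun _ => A))
      ((integrable_indicator_iff hKm).mpr (integrableOn_const hKfin))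
      (Eventually.of_forall fun p => ?_)).trans ?_
    · rw [norm_mul, hen, one_mul]; exact hmb p
    · rw [integral_indicator hKm]
      simp only [integral_const, measureReal_restrict_apply_univ, smul_eq_mul]
      rw [Measure.real, Measure.addHaar_closedBall μ _ (by positivity), ENNReal.toReal_mul,
        ENNReal.toReal_ofReal (by positivity), mul_pow, hC3, Measure.real]
      have hfr : Module.finrank ℝ V ≠ 0 := (Module.finrank_pos (R := ℝ) (M := V)).ne'
      have : r ^ Module.finrank ℝ V ≤ r := pow_le_of_le_one hr0.le hr1 hfr
      calc 2 ^ Module.finrank ℝ V * r ^ Module.finrank ℝ V * (μ (Metric.ball 0 1)).toReal * A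
          ≤ 2 ^ Module.finrank ℝ V * r * (μ (Metric.ball 0 1)).toReal * A := by gcongr
        _ = _ := by ring
  have hsum : ∀ p, e p * b p = ∑ i : t, e p * (ρ i p • b p) := by
    intro p
    by_cases hp : b p = 0
    · simp [hp]
    · have hpK : p ∈ tsupport m := hbsupp (subset_tsupport _ hp)
      have h1 := ρ.sum_eq_one hpK
      rw [finsum_eq_sum_of_fintype] at h1
      rw [← Finset.mul_sum, ← Finset.sum_smul, h1, one_smul]
  have hY : r⁻¹ * lam ^ (-(1 : ℝ) / 2) ≤ r := by
    rw [hr, ← Real.rpow_neg hl0.le, ← Real.rpow_add hl0]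
    apply Real.rpow_le_rpow_of_exponent_le hlam
    have hn' : (2:ℝ) ≤ n := by exact_mod_cast hn
    have : 1 / (2 * (n:ℝ)) ≤ 1 / 4 := one_div_le_one_div_of_le (by norm_num) (by linarith)
    rw [neg_div, neg_div]
    linarith
  have hYY : lam ^ (-(1 : ℝ) / 2) ≤ r := by
    refine le_trans ?_ hY
    have : 1 ≤ r⁻¹ := (one_le_inv₀ hr0).mpr hr1
    exact le_mul_of_one_le_left (by positivity) this
  have part2 : ‖∫ p, e p * b p ∂μ‖ ≤ ∑ i : t, C (i : V) * (A + (D i * A + C2)) * r := by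
    simp_rw [hsum]
    have hρb : ∀ i : t, ContDiff ℝ 1 (fun p => ρ i p • b p) := fun i => (hρs i).smul hbs
    have hρbc : ∀ i : t, HasCompactSupport (fun p => ρ i p • b p) := fun i =>
      hbc.mono (fun p hp h => hp (by simp only [h, smul_zero]))
    rw [integral_finset_sum _ (fun i _ => hmul _ ((hρb i).continuous.integrable_of_hasCompactSupport (hρbc i)))]
    refine (norm_sum_le _ _).trans (Finset.sum_le_sum fun i _ => ?_)
    have hρ1 : ∀ p, ‖ρ i p‖ ≤ 1 := fun p => by
      rw [Real.norm_eq_abs, abs_of_nonneg (ρ.nonneg i p)]; exact ρ.le_one i p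
    have := hbd (i : V) (htK _ i.2) (fun p => ρ i p • b p) (hρb i)
      ((closure_mono (Function.support_smul_subset_left (ρ i) b)).trans (hρ i)) A (D i * A + C2 / r)
      (fun p => by
        rw [norm_smul]
        exact (mul_le_of_le_one_left (norm_nonneg _) (hρ1 p)).trans (hbA p))
      (fun p => by
        have h1 : HasFDerivAt (fun p => ρ i p • b p) _ p :=
          ((hρs i).differentiable (by simp) p).hasFDerivAt.smul (hbs.differentiable (by simp) p).hasFDerivAt
        rw [h1.fderiv]
        refine (norm_add_le _ _).trans ?_
        rw [norm_smul, ContinuousLinearMap.norm_smulRight_apply, add_comm]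
        have h2 := hD i p
        have h3 := hbA p
        have h4 : ‖ρ i p‖ * ‖fderiv ℝ b p‖ ≤ C2 / r :=
          (mul_le_of_le_one_left (norm_nonneg _) (hρ1 p)).trans (hbD p)
        have h5 : ‖fderiv ℝ (ρ i) p‖ * ‖b p‖ ≤ D i * A := by
          have := hD0 i
          gcongr
        linarith) lam hlam L
    refine this.trans ?_
    rw [mul_assoc]
    apply mul_le_mul_of_nonneg_left _ (hC _)
    have h6 : D i * A * lam ^ (-(1 : ℝ) / 2) ≤ D i * A * r := by
      have := hD0 i
      gcongr
    have h7 : C2 / r * lam ^ (-(1 : ℝ) / 2) ≤ C2 * r := by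
      rw [div_eq_mul_inv, mul_assoc]
      gcongr
    nlinarith
  rw [hsplit]
  refine (norm_add_le _ _).trans ?_
  rw [add_mul, Finset.sum_mul]
  exact add_le_add part1 part2

lemma Bop_bound {d : ℕ} (m : E d × E d → ℂ) (hmint : Integrable m) (φ : E d × E d → ℝ) (hφ : Continuous φ)
    (lam K : ℝ)
    (hK : ∀ L : E d × E d →L[ℝ] ℝ,
      ‖∫ p : E d × E d, Complex.exp (Complex.I * ((L p + lam * φ p : ℝ) : ℂ)) * m p‖ ≤ K)
    (f g : 𝓢(E d, ℂ)) (x : E d) :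
    ‖Bop m φ lam f g x‖ ≤ ((2 * Real.pi) ^ (-(d : ℝ) / 2)) ^ 3 * K *
      ((∫ y, ‖f y‖) * ∫ z, ‖g z‖) := by
  set c : ℝ := (2 * Real.pi) ^ (-(d : ℝ) / 2) with hc
  have hc0 : 0 ≤ c := by positivity
  set w : E d × E d → E d × E d → ℂ := fun p q =>
    Complex.exp (Complex.I * ((⟪x - q.1, p.1⟫ + ⟪x - q.2, p.2⟫ + lam * φ p : ℝ) : ℂ)) with hw
  have hwn : ∀ p q, ‖w p q‖ = 1 := fun p q => by
    simp only [hw]; rw [mul_comm]; exact Complex.norm_exp_ofReal_mul_I _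
  have hwc : Continuous (Function.uncurry w) := by
    simp only [hw, Function.uncurry_def]
    fun_prop
  have hfg : Integrable (fun q : E d × E d => f q.1 * g q.2) :=
    Integrable.mul_prod f.integrable g.integrable
  have hall : Integrable (Function.uncurry fun (p q : E d × E d) => w p q * (m p * (f q.1 * g q.2)))
      (volume.prod volume) := by
    have h1 : Integrable (fun z : (E d × E d) × (E d × E d) => m z.1 * (f z.2.1 * g z.2.2))
      (volume.prod volume) := Integrable.mul_prod hmint hfg
    exact h1.bdd_mul (c := 1) hwc.aestronglyMeasurable (Eventually.of_forall fun z => (hwn z.1 z.2).le)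
  have hpt : ∀ p : E d × E d, Complex.exp (Complex.I * ((⟪x, p.1 + p.2⟫ + lam * φ p : ℝ) : ℂ)) *
        m p * FT (⇑f) p.1 * FT (⇑g) p.2 =
      (c : ℂ) ^ 2 * ∫ q : E d × E d, w p q * (m p * (f q.1 * g q.2)) := by
    intro p
    have h2 : ∀ q : E d × E d, w p q * (m p * (f q.1 * g q.2)) =
        (Complex.exp (Complex.I * ((⟪x, p.1 + p.2⟫ + lam * φ p : ℝ) : ℂ)) * m p) *
        ((Complex.exp (-(Complex.I * ((⟪q.1, p.1⟫ : ℝ) : ℂ))) * f q.1) *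
         (Complex.exp (-(Complex.I * ((⟪q.2, p.2⟫ : ℝ) : ℂ))) * g q.2)) := by
      intro q
      have : w p q = Complex.exp (Complex.I * ((⟪x, p.1 + p.2⟫ + lam * φ p : ℝ) : ℂ)) *
          (Complex.exp (-(Complex.I * ((⟪q.1, p.1⟫ : ℝ) : ℂ))) *
           Complex.exp (-(Complex.I * ((⟪q.2, p.2⟫ : ℝ) : ℂ)))) := by
        simp only [hw]
        rw [← Complex.exp_add, ← Complex.exp_add]
        congr 1
        rw [inner_sub_left, inner_sub_left, inner_add_right]
        push_cast
        ring
      rw [this]; ring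
    simp_rw [h2]
    rw [integral_const_mul, Measure.volume_eq_prod,
      integral_prod_mul (μ := (volume : Measure (E d))) (ν := (volume : Measure (E d)))
      (fun y : E d => Complex.exp (-(Complex.I * ((⟪y, p.1⟫ : ℝ) : ℂ))) * f y)
      (fun z : E d => Complex.exp (-(Complex.I * ((⟪z, p.2⟫ : ℝ) : ℂ))) * g z)]
    simp only [FT, ← hc]
    ring
  have hB : Bop m φ lam f g x = (c : ℂ) ^ 3 *
      ∫ q : E d × E d, (f q.1 * g q.2) * ∫ p : E d × E d, w p q * m p := by
    simp only [Bop]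
    simp_rw [hpt]
    rw [integral_const_mul, integral_integral_swap hall, ← hc, ← mul_assoc]
    congr 1
    · ring
    · congr 1
      funext q
      rw [← integral_const_mul]
      congr 1
      funext p
      ring
  have hKq : ∀ q : E d × E d, ‖∫ p : E d × E d, w p q * m p‖ ≤ K := by
    intro q
    have := hK ((innerSL ℝ (x - q.1)).comp (ContinuousLinearMap.fst ℝ (E d) (E d)) +
      (innerSL ℝ (x - q.2)).comp (ContinuousLinearMap.snd ℝ (E d) (E d)))
    simpa [hw, inner_sub_left] using this
  rw [hB, norm_mul, norm_pow, Complex.norm_real, Real.norm_of_nonneg hc0, mul_assoc]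
  apply mul_le_mul_of_nonneg_left _ (by positivity)
  refine (norm_integral_le_of_norm_le (g := fun q : E d × E d => K * (‖f q.1‖ * ‖g q.2‖)) ?_ ?_).trans ?_
  · exact (Integrable.mul_prod f.integrable.norm g.integrable.norm).const_mul K
  · refine Eventually.of_forall fun q => ?_
    rw [norm_mul, norm_mul, mul_comm]
    exact mul_le_mul_of_nonneg_right (hKq q) (by positivity)
  · rw [integral_const_mul, Measure.volume_eq_prod,
      integral_prod_mul (fun y : E d => ‖f y‖) (fun z : E d => ‖g z‖)]


/-- If `m` is a compactly supported Coifman–Meyer symbol and `φ` is smooth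
with `|∂^α φ| ≥ c > 0` on `supp m` for some multi-index `α` with `|α| = n ≥ 2`, then for
`λ ≥ 1`, `‖B_λ(f,g)‖_{L^∞} ≤ C λ^{-1/(2|α|)} ‖f‖_{L^1} ‖g‖_{L^1}`. -/
theorem statement11 {d : ℕ} (m : E d × E d → ℂ)
    (hmCM : CoifmanMeyer m) (hmc : HasCompactSupport m)
    (φ : E d × E d → ℝ) (hφs : ContDiff ℝ (⊤ : ℕ∞) φ)
    (n : ℕ) (hn : 2 ≤ n) (α : Fin n → (Fin d ⊕ Fin d)) (c : ℝ) (hc : 0 < c)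
    (hα : ∀ p ∈ tsupport m,
      c ≤ |iteratedFDeriv ℝ n φ p (fun i => Sum.elim etaV xiV (α i))|) :
    ∃ C : ℝ, ∀ lam : ℝ, 1 ≤ lam → ∀ f g : 𝓢(E d, ℂ),
      eLpNorm (Bop m φ lam f g) ⊤ volume ≤
        ENNReal.ofReal (C * lam ^ (-(1 : ℝ) / (2 * n))) *
          (eLpNorm (⇑f) 1 volume * eLpNorm (⇑g) 1 volume) := by
  have hd : 0 < d := by
    rcases α ⟨0, by omega⟩ with i | i <;> exact i.pos
  have : Nonempty (Fin d) := ⟨⟨0, hd⟩⟩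
  have : Nontrivial (E d) := inferInstance
  have hhaar : (volume : Measure (E d × E d)).IsAddHaarMeasure := by
    rw [Measure.volume_eq_prod]
    infer_instance
  have hopen : IsOpen {p : E d × E d | p ≠ 0} := isOpen_ne
  obtain ⟨hsm, hbd⟩ := hmCM
  obtain ⟨C0, hC0, hb0⟩ := hbd 0
  obtain ⟨C1, hC1, hb1⟩ := hbd 1
  have hA : ∀ p, ‖m p‖ ≤ max C0 ‖m 0‖ := by
    intro p
    by_cases hp : p = 0
    · rw [hp]; exact le_max_right _ _
    · have := hb0 p hp
      rw [norm_iteratedFDerivWithin_zero] at this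
      simp only [Nat.cast_zero, neg_zero, Real.rpow_zero, mul_one] at this
      exact this.trans (le_max_left _ _)
  have hD : ∀ p, p ≠ 0 → ‖fderiv ℝ m p‖ * ‖p‖ ≤ C1 := by
    intro p hp
    have := hb1 p hp
    rw [norm_iteratedFDerivWithin_one _ (hopen.uniqueDiffWithinAt hp),
      fderivWithin_of_isOpen hopen hp] at this
    have hp0 : 0 < ‖p‖ := norm_pos_iff.mpr hp
    have hle : ‖p‖ ≤ ‖p.1‖ + ‖p.2‖ := by
      rw [Prod.norm_def]
      exact max_le (by linarith [norm_nonneg p.2]) (by linarith [norm_nonneg p.1])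
    have hs : 0 < ‖p.1‖ + ‖p.2‖ := hp0.trans_le hle
    simp only [Nat.cast_one, Real.rpow_neg_one] at this
    calc ‖fderiv ℝ m p‖ * ‖p‖ ≤ (C1 * (‖p.1‖ + ‖p.2‖)⁻¹) * (‖p.1‖ + ‖p.2‖) := by gcongr
      _ = C1 := by field_simp
  have hmd : ∀ p, p ≠ 0 → ContDiffAt ℝ 1 m p := fun p hp =>
    ((hsm p hp).contDiffAt (hopen.mem_nhds hp)).of_le (by exact_mod_cast le_top)
  have hmeas : Measurable m := by
    refine measurable_of_measurable_on_compl_singleton 0 ?_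
    exact (hsm.continuousOn.restrict).measurable
  have hmint : Integrable m := by
    have h1 : IntegrableOn m (tsupport m) :=
      Measure.integrableOn_of_bounded (M := max C0 ‖m 0‖) hmc.isCompact.measure_lt_top.ne
        hmeas.aestronglyMeasurable (Eventually.of_forall hA)
    exact (integrableOn_iff_integrable_of_support_subset (subset_tsupport m)).mp h1
  obtain ⟨C, hC, hosc⟩ := global_osc (volume : Measure (E d × E d)) φ hφs n hn
    (fun i => Sum.elim etaV xiV (α i)) m hmc hmd hmint _ C1 hA hD
    (fun p hp h => by
      have := hα p hp
      rw [h, abs_zero] at this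
      linarith)
  refine ⟨((2 * Real.pi) ^ (-(d : ℝ) / 2)) ^ 3 * C, fun lam hlam f g => ?_⟩
  have hf : eLpNorm (⇑f) 1 volume = ENNReal.ofReal (∫ y, ‖f y‖) := by
    rw [eLpNorm_one_eq_lintegral_enorm, ofReal_integral_norm_eq_lintegral_enorm f.integrable]
  have hg : eLpNorm (⇑g) 1 volume = ENNReal.ofReal (∫ y, ‖g y‖) := by
    rw [eLpNorm_one_eq_lintegral_enorm, ofReal_integral_norm_eq_lintegral_enorm g.integrable]
  have hlam0 : 0 ≤ lam := by linarith
  have hI : 0 ≤ ∫ y, ‖f y‖ := integral_nonneg fun _ => norm_nonneg _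
  rw [hf, hg, ← ENNReal.ofReal_mul hI, ← ENNReal.ofReal_mul (by positivity), eLpNorm_exponent_top]
  refine eLpNormEssSup_le_of_ae_bound (Eventually.of_forall fun x => ?_)
  have := Bop_bound m hmint φ hφs.continuous lam _ (fun L => hosc lam hlam L) f g x
  rw [mul_assoc _ C]
  exact this
end
end

section
/- Let φ be a smooth real-valued function on ℝ^{2d} all of whose derivatives have at most polynomial growth, let m be a bounded smooth symbol on ℝ^{2d}, and let p, q, r ∈ [1,∞). Assume there exist ρ > 1 and a constant C₀ such that for all λ ≥ 1 and all Schwartz functions f, g on ℝ^d, ‖B_λ(f,g)‖_{L^r} ≤ C₀ λ^{−ρ} ‖f‖_{L^p} ‖g‖_{L^q}. For T ≥ 1 define the symbol σ_T(η,ξ) = −e^{iφ(η,ξ)} ((e^{iTφ(η,ξ)} − 1)/φ(η,ξ)) m(η,ξ) (interpreted with the quotient equal to iT where φ vanishes), and the bilinear operator T_{σ_T}(f,g)(x) = (2π)^{−d/2} ∫_{ℝ^{2d}} e^{i x·(η+ξ)} σ_T(η,ξ) f̂(η) ĝ(ξ) dη dξ. Then for all Schwartz functions f, g on ℝ^d,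 T_{σ_T}(f,g) converges in L^r(ℝ^d) as T → ∞, and there is a constant C such that the limit T_∞(f,g) satisfies ‖T_∞(f,g)‖_{L^r} ≤ C ‖f‖_{L^p} ‖g‖_{L^q}; i.e. the bilinear multiplier with symbol e^{iφ} F.P.(1/φ) m is bounded from L^p(ℝ^d) × L^q(ℝ^d) into L^r(ℝ^d). -/
open MeasureTheory Filter Complex SchwartzMap
open scoped RealInnerProductSpace ENNReal

noncomputable section

/-- The truncated "finite part" symbol
`σ_T = -e^{iφ} ((e^{iTφ}-1)/φ) m`, with the quotient interpreted as `iT` where `φ = 0`. -/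
def sigmaT {d : ℕ} (φ : E d × E d → ℝ) (m : E d × E d → ℂ) (T : ℝ)
    (p : E d × E d) : ℂ :=
  -(Complex.exp (Complex.I * ((φ p : ℝ) : ℂ)) *
      (if φ p = 0 then Complex.I * (T : ℂ)
        else (Complex.exp (Complex.I * ((T * φ p : ℝ) : ℂ)) - 1) / ((φ p : ℝ) : ℂ)) *
    m p)

/-- The bilinear multiplier `T_σ` associated with a symbol `σ`. -/
def Tmul {d : ℕ} (σ : E d × E d → ℂ) (f g : 𝓢(E d, ℂ)) (x : E d) : ℂ :=
  (((2 * Real.pi) ^ (-(d : ℝ) / 2) : ℝ) : ℂ) *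
    ∫ p : E d × E d,
      Complex.exp (Complex.I * ((⟪x, p.1 + p.2⟫ : ℝ) : ℂ)) *
        σ p * FT (⇑f) p.1 * FT (⇑g) p.2

open scoped FourierTransform in
lemma FT_eq {d : ℕ} (f : 𝓢(E d, ℂ)) (ξ : E d) :
    FT (⇑f) ξ = (((2 * Real.pi) ^ (-(d : ℝ) / 2) : ℝ) : ℂ) * (𝓕 f) ((2 * Real.pi)⁻¹ • ξ) := by
  rw [SchwartzMap.fourier_coe, Real.fourier_eq']
  unfold FT
  congr 1
  refine integral_congr_ae (Eventually.of_forall fun x => ?_)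
  simp only [smul_eq_mul]
  congr 2
  rw [inner_smul_right]
  have : (-2 * Real.pi * ((2 * Real.pi)⁻¹ * ⟪x, ξ⟫) : ℝ) = - ⟪x, ξ⟫ := by
    have := Real.pi_pos.ne'
    field_simp
  rw [this]
  push_cast
  ring

open scoped FourierTransform in
lemma FT_cont {d : ℕ} (f : 𝓢(E d, ℂ)) : Continuous (FT (⇑f)) := by
  have : FT (⇑f) = fun ξ => (((2 * Real.pi) ^ (-(d : ℝ) / 2) : ℝ) : ℂ) *
      (𝓕 f) ((2 * Real.pi)⁻¹ • ξ) := funext (FT_eq f)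
  rw [this]
  exact continuous_const.mul ((𝓕 f).continuous.comp (continuous_const_smul _))

open scoped FourierTransform in
lemma FT_int {d : ℕ} (f : 𝓢(E d, ℂ)) : Integrable (FT (⇑f)) volume := by
  have : FT (⇑f) = fun ξ => (((2 * Real.pi) ^ (-(d : ℝ) / 2) : ℝ) : ℂ) *
      (𝓕 f) ((2 * Real.pi)⁻¹ • ξ) := funext (FT_eq f)
  rw [this]
  refine Integrable.const_mul ?_ _
  exact ((𝓕 f).integrable (μ := volume)).comp_smul (inv_ne_zero (by positivity))

lemma meas_swap {X Y Z : Type*} [MeasurableSpace X] [MeasurableSpace Y] [MeasurableSpace Z]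
    (F : X → Y → Z) (h : Measurable (Function.uncurry F)) :
    Measurable (Function.uncurry fun y x => F x y) := h.comp measurable_swap

lemma jensen_aux {Λ : Type*} [MeasurableSpace Λ] (ν : Measure Λ) (h : Λ → ℝ≥0∞)
    (hh : Measurable h) (r : ℝ) (hr : 1 ≤ r) :
    (∫⁻ l, h l ∂ν) ^ r ≤ (∫⁻ l, h l ^ r ∂ν) * ν Set.univ ^ (r - 1) := by
  have hr0 : 0 < r := by linarith
  have := eLpNorm'_le_eLpNorm'_mul_rpow_measure_univ (μ := ν) (f := h) one_pos hr
    hh.aestronglyMeasurable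
  simp only [eLpNorm'_eq_lintegral_enorm, enorm_eq_self, ENNReal.rpow_one, div_one] at this
  calc (∫⁻ l, h l ∂ν) ^ r ≤ ((∫⁻ l, h l ^ r ∂ν) ^ (1 / r) * ν Set.univ ^ (1 - 1 / r)) ^ r := by
        gcongr
    _ = _ := by
        rw [ENNReal.mul_rpow_of_nonneg _ _ hr0.le, ← ENNReal.rpow_mul, ← ENNReal.rpow_mul]
        congr 2
        · rw [one_div_mul_cancel hr0.ne', ENNReal.rpow_one]
        · field_simp

lemma mink_aux {X Λ : Type*} [MeasurableSpace X] [MeasurableSpace Λ] (μ : Measure X) [SFinite μ]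
    (ν : Measure Λ) [SFinite ν] (h : X → Λ → ℝ≥0∞)
    (hh : Measurable (Function.uncurry h)) (r : ℝ) (hr : 1 ≤ r) (A : ℝ≥0∞)
    (hA : ∀ᵐ l ∂ν, ∫⁻ x, h x l ^ r ∂μ ≤ A ^ r) :
    ∫⁻ x, (∫⁻ l, h x l ∂ν) ^ r ∂μ ≤ (A * ν Set.univ) ^ r := by
  have hr0 : 0 < r := by linarith
  have hm : Measurable (Function.uncurry fun x l => h x l ^ r) := hh.pow_const r
  calc ∫⁻ x, (∫⁻ l, h x l ∂ν) ^ r ∂μ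
      ≤ ∫⁻ x, (∫⁻ l, h x l ^ r ∂ν) * ν Set.univ ^ (r - 1) ∂μ :=
        lintegral_mono fun x => jensen_aux ν _ hh.of_uncurry_left r hr
    _ = (∫⁻ x, (∫⁻ l, h x l ^ r ∂ν) ∂μ) * ν Set.univ ^ (r - 1) :=
        lintegral_mul_const _ hm.lintegral_prod_right
    _ = (∫⁻ l, (∫⁻ x, h x l ^ r ∂μ) ∂ν) * ν Set.univ ^ (r - 1) := by
        rw [lintegral_lintegral_swap hm.aemeasurable]
    _ ≤ (∫⁻ _, A ^ r ∂ν) * ν Set.univ ^ (r - 1) := by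
        gcongr ?_ * _
        exact lintegral_mono_ae hA
    _ = (A * ν Set.univ) ^ r := by
        rw [lintegral_const, mul_assoc, ENNReal.mul_rpow_of_nonneg _ _ hr0.le]
        congr 1
        nth_rw 1 [← ENNReal.rpow_one (ν Set.univ)]
        rw [← ENNReal.rpow_add_of_nonneg _ _ zero_le_one (by linarith)]
        congr 1; ring

lemma mink_decay {X : Type*} [MeasurableSpace X] (μ : Measure X) [SFinite μ]
    (K : ℝ → X → ℂ) (hK : Measurable (Function.uncurry K)) (r : ℝ) (hr : 1 ≤ r)
    (ρ : ℝ) (hρ : 1 < ρ) (C₀ : ℝ) (N : ℝ≥0∞)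
    (hd : ∀ lam : ℝ, 1 ≤ lam → eLpNorm (K lam) (ENNReal.ofReal r) μ ≤
      ENNReal.ofReal (C₀ * lam ^ (-ρ)) * N) (a : ℝ) (ha : 1 ≤ a) :
    ∫⁻ x, (∫⁻ l in Set.Ioi a, ‖K l x‖ₑ) ^ r ∂μ ≤
      (ENNReal.ofReal C₀ * N * ENNReal.ofReal (a ^ (1 - ρ) / (ρ - 1))) ^ r := by
  have hr0 : 0 < r := by linarith
  have ha0 : 0 < a := by linarith
  set w : ℝ → ℝ≥0∞ := fun l => ENNReal.ofReal (l ^ (-ρ)) with hw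
  have hwm : Measurable w := by fun_prop
  have hwpos : ∀ l, a < l → w l ≠ 0 := fun l hl => by
    have : 0 < l := by linarith
    simp only [hw, ne_eq, ENNReal.ofReal_eq_zero, not_le]
    positivity
  have hwtop : ∀ l, w l ≠ ⊤ := fun l => ENNReal.ofReal_ne_top
  set ν := (volume.restrict (Set.Ioi a)).withDensity w with hν
  have hνu : ν Set.univ = ENNReal.ofReal (a ^ (1 - ρ) / (ρ - 1)) := by
    rw [hν, withDensity_apply _ MeasurableSet.univ, Measure.restrict_univ, hw,
      ← ofReal_integral_eq_lintegral_ofReal]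
    · rw [integral_Ioi_rpow_of_lt (by linarith) ha0]
      congr 1
      rw [neg_div, ← div_neg]
      congr 1
      · congr 1; ring
      · ring
    · exact integrableOn_Ioi_rpow_of_lt (by linarith) ha0
    · filter_upwards [ae_restrict_mem measurableSet_Ioi] with l hl
      have : 0 < l := ha0.trans hl
      positivity
  set h : X → ℝ → ℝ≥0∞ := fun x l => (w l)⁻¹ * ‖K l x‖ₑ with hh
  have hhm : Measurable (Function.uncurry h) := by
    have h1 : Measurable fun z : X × ℝ => K z.2 z.1 := meas_swap K hK
    exact (hwm.comp measurable_snd).inv.mul h1.enorm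
  have key := mink_aux μ ν h hhm r hr (ENNReal.ofReal C₀ * N) ?_
  · rw [hνu] at key
    refine le_trans (le_of_eq ?_) key
    refine lintegral_congr fun x => ?_
    congr 1
    have hxm : Measurable (h x) := hhm.of_uncurry_left
    rw [hν, lintegral_withDensity_eq_lintegral_mul _ hwm hxm]
    refine setLIntegral_congr_fun measurableSet_Ioi fun l hl => ?_
    simp only [hh, Pi.mul_apply]
    rw [← mul_assoc, ENNReal.mul_inv_cancel (hwpos l hl) (hwtop l), one_mul]
  · have hac : ν ≪ volume.restrict (Set.Ioi a) := withDensity_absolutelyContinuous _ _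
    refine hac.ae_le ?_
    filter_upwards [ae_restrict_mem measurableSet_Ioi] with l hl
    have hl' : a < l := hl
    have hl1 : 1 ≤ l := by linarith
    have hl0 : 0 < l := by linarith
    have e1 := hd l hl1
    have hKl : Measurable (K l) := hK.of_uncurry_left
    rw [eLpNorm_eq_lintegral_rpow_enorm_toReal (by simpa using hr0) ENNReal.ofReal_ne_top,
      ENNReal.toReal_ofReal hr0.le] at e1
    have e2 := (ENNReal.rpow_le_rpow e1 hr0.le)
    rw [← ENNReal.rpow_mul, one_div_mul_cancel hr0.ne', ENNReal.rpow_one] at e2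
    simp only [hh]
    simp_rw [ENNReal.mul_rpow_of_nonneg _ _ hr0.le]
    rw [lintegral_const_mul _ (hKl.enorm.pow_const r)]
    refine (mul_le_mul_right e2 _).trans ?_
    rw [← ENNReal.mul_rpow_of_nonneg _ _ hr0.le, ← ENNReal.mul_rpow_of_nonneg _ _ hr0.le]
    refine ENNReal.rpow_le_rpow ?_ hr0.le
    have : ENNReal.ofReal (C₀ * l ^ (-ρ)) = ENNReal.ofReal C₀ * w l := by
      rw [ENNReal.ofReal_mul' (by positivity)]
    rw [this, mul_comm (ENNReal.ofReal C₀), mul_assoc, ← mul_assoc,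
      ENNReal.inv_mul_cancel (hwpos l hl) (hwtop l), one_mul]

lemma sigma_eq (y : ℝ) (T : ℝ) :
    (-(Complex.exp (Complex.I * (y : ℂ)) *
      (if y = 0 then Complex.I * (T : ℂ)
        else (Complex.exp (Complex.I * ((T * y : ℝ) : ℂ)) - 1) / (y : ℂ)))) =
    -Complex.I * ∫ l in (1:ℝ)..(T + 1), Complex.exp (Complex.I * ((l * y : ℝ) : ℂ)) := by
  split_ifs with h
  · subst h
    simp
  · have h0 : Complex.I * (y : ℂ) ≠ 0 := by simp [h]
    have : ∀ l : ℝ, Complex.I * ((l * y : ℝ) : ℂ) = (Complex.I * y) * l := fun l => by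
      push_cast; ring
    simp_rw [this]
    rw [integral_exp_mul_complex h0]
    have e : Complex.I * (y:ℂ) * ((T + 1 : ℝ) : ℂ) = Complex.I * y + Complex.I * y * T := by
      push_cast; ring
    rw [e, Complex.exp_add]
    have hy : (y : ℂ) ≠ 0 := by simpa using h
    field_simp
    simp only [ofReal_one]
    ring

section
variable {d : ℕ} (φ : E d × E d → ℝ) (m : E d × E d → ℂ) (f g : 𝓢(E d, ℂ))

def Jint (x : E d) (l : ℝ) (p : E d × E d) : ℂ :=
  Complex.exp (Complex.I * ((⟪x, p.1 + p.2⟫ + l * φ p : ℝ) : ℂ)) *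
        m p * FT (⇑f) p.1 * FT (⇑g) p.2

lemma Jint_cont (hφ : Continuous φ) (hm : Continuous m) :
    Continuous fun z : (ℝ × E d) × (E d × E d) => Jint φ m f g z.1.2 z.1.1 z.2 := by
  have h1 := FT_cont f
  have h2 := FT_cont g
  unfold Jint
  fun_prop

lemma Bop_meas (hφ : Continuous φ) (hm : Continuous m) :
    Measurable (Function.uncurry fun l x => Bop m φ l f g x) := by
  have h := (Jint_cont φ m f g hφ hm).stronglyMeasurable
  have h2 := h.integral_prod_right' (ν := (volume : Measure (E d × E d)))
  exact (h2.measurable.const_mul _)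

lemma Jint_int (hφ : Continuous φ) (hm : Continuous m) (M : ℝ) (hM : ∀ p, ‖m p‖ ≤ M) (x : E d)
    (ν : Measure ℝ) [IsFiniteMeasure ν] :
    Integrable (Function.uncurry (fun p l => Jint φ m f g x l p)) ((volume : Measure (E d × E d)).prod ν) := by
  have hG : Integrable (fun p : E d × E d => FT (⇑f) p.1 * FT (⇑g) p.2) volume :=
    (FT_int f).mul_prod (FT_int g)
  have hG2 := ((hG.norm.const_mul M).comp_fst ν)
  refine hG2.mono' ?_ ?_
  · have h3 := FT_cont f
    have h4 := FT_cont g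
    have h2 : Continuous fun z : (E d × E d) × ℝ => Jint φ m f g x z.2 z.1 := by
      unfold Jint
      fun_prop
    exact h2.aestronglyMeasurable
  · refine Eventually.of_forall fun z => ?_
    simp only [Function.uncurry, Jint]
    rw [mul_assoc, norm_mul, norm_mul, mul_comm Complex.I, Complex.norm_exp_ofReal_mul_I, one_mul]
    exact mul_le_mul_of_nonneg_right (hM _) (norm_nonneg _)

lemma Tmul_eq (hφ : Continuous φ) (hm : Continuous m) (M : ℝ) (hM : ∀ p, ‖m p‖ ≤ M) (x : E d)
    (T : ℝ) (hT : 0 ≤ T) :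
    Tmul (sigmaT φ m T) f g x = -Complex.I * ∫ l in Set.Ioc 1 (T + 1), Bop m φ l f g x := by
  have hs := integral_integral_swap (Jint_int φ m f g hφ hm M hM x
    (volume.restrict (Set.Ioc 1 (T + 1))))
  have hB : ∀ l, Bop m φ l f g x = (((2 * Real.pi) ^ (-(d : ℝ) / 2) : ℝ) : ℂ) *
    ∫ p, Jint φ m f g x l p := fun l => rfl
  simp_rw [hB]
  rw [integral_const_mul, ← hs, mul_left_comm, ← integral_const_mul]
  unfold Tmul
  congr 1
  refine integral_congr_ae (Eventually.of_forall fun p => ?_)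
  simp only
  have hσ : sigmaT φ m T p = (-Complex.I * ∫ l in Set.Ioc 1 (T + 1),
      Complex.exp (Complex.I * ((l * φ p : ℝ) : ℂ))) * m p := by
    rw [← intervalIntegral.integral_of_le (by linarith), ← sigma_eq]
    unfold sigmaT
    ring
  have hJ : ∀ l, Jint φ m f g x l p = Complex.exp (Complex.I * ((l * φ p : ℝ) : ℂ)) *
      (Complex.exp (Complex.I * ((⟪x, p.1 + p.2⟫ : ℝ) : ℂ)) * m p * FT (⇑f) p.1 * FT (⇑g) p.2) := by
    intro l
    unfold Jint
    rw [ofReal_add, mul_add, Complex.exp_add]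
    ring
  simp_rw [hJ]
  rw [integral_mul_const, hσ]
  ring
end

/-- If `‖B_λ(f,g)‖_{L^r} ≤ C₀ λ^{-ρ} ‖f‖_{L^p} ‖g‖_{L^q}` for some `ρ > 1`,
then for Schwartz `f, g` the truncated multipliers `T_{σ_T}(f,g)` converge in `L^r` as
`T → ∞`, and the limit satisfies `‖T_∞(f,g)‖_{L^r} ≤ C ‖f‖_{L^p} ‖g‖_{L^q}`: the bilinear
multiplier with symbol `e^{iφ} F.P.(1/φ) m` is bounded from `L^p × L^q` to `L^r`. -/
theorem statement19 {d : ℕ} (φ : E d × E d → ℝ) (hφs : ContDiff ℝ (⊤ : ℕ∞) φ)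
    (hgrowth : ∀ k : ℕ, ∃ C N : ℝ, ∀ x : E d × E d,
      ‖iteratedFDeriv ℝ k φ x‖ ≤ C * (1 + ‖x‖) ^ N)
    (m : E d × E d → ℂ) (hms : ContDiff ℝ (⊤ : ℕ∞) m) (hmb : ∃ M : ℝ, ∀ p, ‖m p‖ ≤ M)
    (p q r : ℝ) (hp : 1 ≤ p) (hq : 1 ≤ q) (hr : 1 ≤ r)
    (ρ : ℝ) (hρ : 1 < ρ) (C₀ : ℝ)
    (hdecay : ∀ lam : ℝ, 1 ≤ lam → ∀ f g : 𝓢(E d, ℂ),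
      eLpNorm (Bop m φ lam f g) (ENNReal.ofReal r) volume ≤
        ENNReal.ofReal (C₀ * lam ^ (-ρ)) *
          (eLpNorm (⇑f) (ENNReal.ofReal p) volume *
            eLpNorm (⇑g) (ENNReal.ofReal q) volume)) :
    ∃ C : ℝ, ∀ f g : 𝓢(E d, ℂ), ∃ Tinf : E d → ℂ,
      Tendsto
        (fun T : ℝ =>
          eLpNorm (fun x => Tmul (sigmaT φ m T) f g x - Tinf x) (ENNReal.ofReal r) volume)
        atTop (nhds 0) ∧
      eLpNorm Tinf (ENNReal.ofReal r) volume ≤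
        ENNReal.ofReal C *
          (eLpNorm (⇑f) (ENNReal.ofReal p) volume *
            eLpNorm (⇑g) (ENNReal.ofReal q) volume) := by
  have hφ : Continuous φ := hφs.continuous
  have hm : Continuous m := hms.continuous
  obtain ⟨M, hM⟩ := hmb
  have hr0 : 0 < r := by linarith
  refine ⟨C₀ * (1 / (ρ - 1)), fun f g => ?_⟩
  set N := eLpNorm (⇑f) (ENNReal.ofReal p) volume * eLpNorm (⇑g) (ENNReal.ofReal q) volume with hN
  have hNtop : N ≠ ⊤ := ENNReal.mul_ne_top (f.memLp _ _).eLpNorm_ne_top (g.memLp _ _).eLpNorm_ne_top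
  set K : ℝ → E d → ℂ := fun l x => Bop m φ l f g x with hK
  have hKm : Measurable (Function.uncurry K) := Bop_meas φ m f g hφ hm
  have mink := mink_decay (volume : Measure (E d)) K hKm r hr ρ hρ C₀ N
    (fun l hl => hdecay l hl f g)
  -- the norm estimate for tails
  have tail : ∀ a : ℝ, 1 ≤ a → ∀ F : E d → ℂ,
      (∀ᵐ x, ‖F x‖ₑ ≤ ∫⁻ l in Set.Ioi a, ‖K l x‖ₑ) →
      eLpNorm F (ENNReal.ofReal r) volume ≤
        ENNReal.ofReal C₀ * N * ENNReal.ofReal (a ^ (1 - ρ) / (ρ - 1)) := by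
    intro a ha F hF
    rw [eLpNorm_eq_lintegral_rpow_enorm_toReal (by simpa using hr0) ENNReal.ofReal_ne_top,
      ENNReal.toReal_ofReal hr0.le, one_div]
    rw [ENNReal.rpow_inv_le_iff hr0]
    refine le_trans (lintegral_mono_ae ?_) (mink a ha)
    filter_upwards [hF] with x hx
    exact ENNReal.rpow_le_rpow hx hr0.le
  have hint : ∀ᵐ x, IntegrableOn (fun l => K l x) (Set.Ioi 1) := by
    have hmeas : Measurable fun x => (∫⁻ l in Set.Ioi (1:ℝ), ‖K l x‖ₑ) ^ r := by
      have h1 : Measurable fun z : E d × ℝ => K z.2 z.1 := meas_swap K hKm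
      exact (Measurable.lintegral_prod_right (f := fun x l => ‖K l x‖ₑ) h1.enorm).pow_const r
    have hfin : ∫⁻ x, (∫⁻ l in Set.Ioi (1:ℝ), ‖K l x‖ₑ) ^ r ≠ ⊤ := by
      refine ((mink 1 le_rfl).trans_lt ?_).ne
      refine ENNReal.rpow_lt_top_of_nonneg hr0.le ?_
      exact ENNReal.mul_ne_top (ENNReal.mul_ne_top ENNReal.ofReal_ne_top hNtop)
        ENNReal.ofReal_ne_top
    filter_upwards [ae_lt_top hmeas hfin] with x hx
    have hx' := (ENNReal.rpow_lt_top_iff_of_pos hr0).1 hx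
    exact ⟨(hKm.of_uncurry_right : Measurable fun l => K l x).aestronglyMeasurable, hx'⟩
  refine ⟨fun x => -Complex.I * ∫ l in Set.Ioi (1:ℝ), K l x, ?_, ?_⟩
  · have hb : ∀ᶠ T : ℝ in atTop,
        eLpNorm (fun x => Tmul (sigmaT φ m T) f g x - -Complex.I * ∫ l in Set.Ioi (1:ℝ), K l x)
          (ENNReal.ofReal r) volume ≤
        ENNReal.ofReal C₀ * N * ENNReal.ofReal ((T + 1) ^ (1 - ρ) / (ρ - 1)) := by
      filter_upwards [eventually_ge_atTop 0] with T hT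
      refine tail (T + 1) (by linarith) _ ?_
      filter_upwards [hint] with x hx
      rw [Tmul_eq φ m f g hφ hm M hM x T hT]
      have hsplit : ∫ l in Set.Ioi (1:ℝ), K l x =
          (∫ l in Set.Ioc 1 (T + 1), K l x) + ∫ l in Set.Ioi (T + 1), K l x := by
        rw [← setIntegral_union Set.Ioc_disjoint_Ioi_same measurableSet_Ioi
          (hx.mono_set Set.Ioc_subset_Ioi_self)
          (hx.mono_set (Set.Ioi_subset_Ioi (by linarith))),
          Set.Ioc_union_Ioi_eq_Ioi (by linarith)]
      rw [hsplit]
      have e : -Complex.I * (∫ l in Set.Ioc 1 (T + 1), Bop m φ l f g x) -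
          -Complex.I * ((∫ l in Set.Ioc 1 (T + 1), K l x) + ∫ l in Set.Ioi (T + 1), K l x) =
          Complex.I * ∫ l in Set.Ioi (T + 1), K l x := by
        simp only [hK]; ring
      rw [e, enorm_mul]
      have hI : ‖Complex.I‖ₑ = 1 := by simp [← ofReal_norm_eq_enorm]
      rw [hI, one_mul]
      exact enorm_integral_le_lintegral_enorm _
    refine tendsto_of_tendsto_of_tendsto_of_le_of_le' tendsto_const_nhds ?_
      (Eventually.of_forall fun _ => zero_le) hb
    have h1 : Tendsto (fun T : ℝ => (T + 1) ^ (1 - ρ) / (ρ - 1)) atTop (nhds 0) := by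
      have := (tendsto_rpow_neg_atTop (y := ρ - 1) (by linarith)).comp
        (tendsto_atTop_add_const_right atTop (1:ℝ) tendsto_id)
      have := this.div_const (ρ - 1)
      simpa [Function.comp_def] using this
    have h2 := ENNReal.Tendsto.const_mul (a := ENNReal.ofReal C₀ * N) (ENNReal.tendsto_ofReal h1)
      (Or.inr (ENNReal.mul_ne_top ENNReal.ofReal_ne_top hNtop))
    simpa using h2
  · refine (tail 1 le_rfl _ (Eventually.of_forall fun x => ?_)).trans (le_of_eq ?_)
    · rw [enorm_mul]
      have hI : ‖-Complex.I‖ₑ = 1 := by simp [← ofReal_norm_eq_enorm]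
      rw [hI, one_mul]
      exact enorm_integral_le_lintegral_enorm _
    · rw [Real.one_rpow, ENNReal.ofReal_mul' (by
        have : 0 < ρ - 1 := by linarith
        positivity)]
      ring
end
end
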